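/- Let $1<s<\alpha<2$ and $n>2s$, and assume $\frac{n}{n-s}>2\alpha^{\sharp}$, where $\alpha^{\sharp}$ is the second largest real root of $X^3-8X+4$. Let $u\in C^{2\alpha}(\mathbb{R}^n)$ with $\int_{\mathbb{R}^n}|u(z)|(1+|z|)^{-n-s}dz<\infty$ solve $(-\Delta)^s u=e^u$ in the sense that $v:=(-\Delta)^{s/2}u$ is everywhere defined, $v(x)\to0$ as $|x|\to\infty$, and $(-\Delta)^{s/2}v=e^u$ pointwise; assume $u$ is stable outside a compact set. For $\lambda\ge1$ set $u^\lambda(x)=u(\lambda x)+2s\log\lambda$, $w^\lambda(x)=c(n,s)\int_{\mathbb{R}^n}\big(\frac{1}{|x-z|^{n-2s}}-\frac{1}{(1+|z|)^{n-2s}}\big)e^{u^\lambda(z)}\,dz$ with $c(n,s)=\frac{\Gamma(\frac n2-s)}{4^{s}\pi^{n/2}\Gamma(s)}$, and let $w_e^\lambda(x,y)=\int_{\mathbb{R}^n}P_s(x-z,y)\,w^\lambda(z)\,dz$ with $P_s(x,y)=\frac{\Gamma(\frac n2+s)}{\Gamma(s)\pi^{n/2}}\,y^{2s}(|x|^2+y^2)^{-\frac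 n2-s}$. Then for every $r\ge1$ there is a constant $C(r)$, independent of $\lambda$, such that $\int_{B_r^{n+1}\cap\mathbb{R}^{n+1}_+} y^{3-2s}\,|w_e^\lambda(x,y)|^2\,dx\,dy \le C(r)$ for all $\lambda\ge1$. -/

import Mathlib

open MeasureTheory Metric Filter Set

noncomputable section

/-- Euclidean space `ℝ^n`. -/
abbrev En (n : ℕ) : Type := EuclideanSpace ℝ (Fin n)

/-- The Laplacian of `f` at `x`: the trace of the Hessian,
`Δ f (x) = ∑ i ∂²f/∂xᵢ² (x)`. -/
def lap {m : ℕ} (f : EuclideanSpace ℝ (Fin m) → ℝ) (x : EuclideanSpace ℝ (Fin m)) : ℝ :=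
  ∑ i, fderiv ℝ (fun y => fderiv ℝ f y (EuclideanSpace.single i (1:ℝ))) x
      (EuclideanSpace.single i (1:ℝ))

/-- The normalizing constant `c_{n,σ} = 4^σ Γ(n/2+σ) / (π^{n/2} |Γ(-σ)|)` of the fractional
Laplacian `(-Δ)^σ`. -/
def cFrac (n : ℕ) (σ : ℝ) : ℝ :=
  (4:ℝ) ^ σ * Real.Gamma ((n : ℝ) / 2 + σ) / (Real.pi ^ ((n : ℝ) / 2) * |Real.Gamma (-σ)|)

/-- The truncated singular integral `∫_{|x-z| ≥ ε} (w(x)-w(z))/|x-z|^{n+2σ} dz`. -/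
def truncInt (n : ℕ) (σ : ℝ) (w : En n → ℝ) (x : En n) (ε : ℝ) : ℝ :=
  ∫ z in {z : En n | ε ≤ dist x z}, (w x - w z) / dist x z ^ ((n : ℝ) + 2 * σ)

/-- The fractional Laplacian `(-Δ)^σ w (x)`, defined as the principal value
`c_{n,σ} p.v.∫ (w(x)-w(z))/|x-z|^{n+2σ} dz` (via the limit of truncated integrals as ε → 0⁺). -/
def fracLap (n : ℕ) (σ : ℝ) (w : En n → ℝ) (x : En n) : ℝ :=
  cFrac n σ * limUnder (nhdsWithin 0 (Set.Ioi 0)) (truncInt n σ w x)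

/-- `HasFracLap n σ w g` means: for every `x` the principal value defining `(-Δ)^σ w (x)`
converges, with value `g x`. -/
def HasFracLap (n : ℕ) (σ : ℝ) (w g : En n → ℝ) : Prop :=
  ∀ x, Filter.Tendsto (fun ε => cFrac n σ * truncInt n σ w x ε)
    (nhdsWithin 0 (Set.Ioi 0)) (nhds (g x))

/-- `φ ∈ C_c^∞(S)`: smooth, compactly supported, with (closed) support contained in `S`. -/
def TestOn (n : ℕ) (S : Set (En n)) (φ : En n → ℝ) : Prop :=
  ContDiff ℝ (⊤ : ℕ∞) φ ∧ HasCompactSupport φ ∧ tsupport φ ⊆ S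

/-- Membership in the Hölder space `C^γ(ℝ^n)` (for non-integer `γ`): `u` is `⌊γ⌋` times
continuously differentiable and its `⌊γ⌋`-th derivative is Hölder continuous of
exponent `γ - ⌊γ⌋`. -/
def CHolder {n : ℕ} (γ : ℝ) (u : En n → ℝ) : Prop :=
  ContDiff ℝ (⌊γ⌋₊ : ℕ) u ∧
    ∃ C : NNReal, HolderWith C (γ - (⌊γ⌋₊ : ℝ)).toNNReal (iteratedFDeriv ℝ ⌊γ⌋₊ u)

/-- `u` is stable outside the ball `B_R`:
`∫ e^u φ² ≤ ∫ |(-Δ)^{s/2} φ|²` for all `φ ∈ C_c^∞(ℝ^n \ closure B_R)`. -/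
def StableOutsideBall (n : ℕ) (s : ℝ) (u : En n → ℝ) (R : ℝ) : Prop :=
  ∀ φ : En n → ℝ, TestOn n (Metric.closedBall (0 : En n) R)ᶜ φ →
    ∫ x, Real.exp (u x) * φ x ^ 2 ≤ ∫ x, (fracLap n (s / 2) φ x) ^ 2

/-- Euclidean space `ℝ^{n+1}`; the last coordinate is the special direction `y`. -/
abbrev E1 (n : ℕ) : Type := EuclideanSpace ℝ (Fin (n + 1))

/-- The horizontal projection `ℝ^{n+1} → ℝ^n`. -/
def projx (n : ℕ) (X : E1 n) : En n :=
  (EuclideanSpace.equiv (Fin n) ℝ).symm (fun i => X (Fin.castSucc i))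

/-- The Riesz normalization `c(n,s) = Γ(n/2 - s)/(4^s π^{n/2} Γ(s))`. -/
def cRiesz (n : ℕ) (s : ℝ) : ℝ :=
  Real.Gamma ((n : ℝ) / 2 - s) / ((4:ℝ) ^ s * Real.pi ^ ((n : ℝ) / 2) * Real.Gamma s)

/-- The Poisson kernel `P_s(x,y) = κ_{n,s} y^{2s} (|x|² + y²)^{-(n/2+s)}` with
`κ_{n,s} = Γ(n/2+s)/(Γ(s) π^{n/2})`. -/
def Ps (n : ℕ) (s : ℝ) (x : En n) (y : ℝ) : ℝ :=
  (Real.Gamma ((n : ℝ) / 2 + s) / (Real.Gamma s * Real.pi ^ ((n : ℝ) / 2))) *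
    y ^ (2 * s) / ((‖x‖ ^ 2 + y ^ 2) ^ ((n : ℝ) / 2 + s))

/-- The rescaling `u^λ(x) = u(λ x) + 2s log λ`. -/
def uscale (n : ℕ) (s : ℝ) (u : En n → ℝ) (l : ℝ) (x : En n) : ℝ :=
  u (l • x) + 2 * s * Real.log l

/-- The potential `w(x) = c(n,s) ∫ (|x-z|^{2s-n} - (1+|z|)^{2s-n}) e^{g(z)} dz`. -/
def wpot (n : ℕ) (s : ℝ) (g : En n → ℝ) (x : En n) : ℝ :=
  cRiesz n s * ∫ z : En n,
    (1 / ‖x - z‖ ^ ((n : ℝ) - 2 * s) - 1 / (1 + ‖z‖) ^ ((n : ℝ) - 2 * s)) * Real.exp (g z)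

/-- The Poisson extension of `g : ℝ^n → ℝ` to the upper half-space `ℝ^{n+1}_+`. -/
def poissonExt (n : ℕ) (s : ℝ) (g : En n → ℝ) (X : E1 n) : ℝ :=
  ∫ z : En n, Ps n s (projx n X - z) (X (Fin.last n)) * g z

section DyadicSums

variable {E : Type*} [NormedAddCommGroup E] [MeasurableSpace E] [BorelSpace E]

/-- If almost every point lies in one of the sets `S k` where `f` is at most `c k`, and the products
`c k * ν (S k)` decay geometrically, then `∫⁻ f` is bounded by the geometric series. -/
theorem lintegral_le_of_geometric_cover {Y : Type*} [MeasurableSpace Y] {ν : Measure Y}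
    {f : Y → ENNReal} {S : ℕ → Set Y} {c : ℕ → ENNReal} {D q : ℝ} (hD : 0 ≤ D) (hq : 0 ≤ q)
    (hq1 : q < 1) (hS : ∀ k, MeasurableSet (S k))
    (hf : ∀ᵐ z ∂ν, ∃ k, z ∈ S k ∧ f z ≤ c k)
    (hc : ∀ k, c k * ν (S k) ≤ ENNReal.ofReal (D * q ^ k)) :
    ∫⁻ z, f z ∂ν ≤ ENNReal.ofReal (D * (1 - q)⁻¹) := by
  calc ∫⁻ z, f z ∂ν ≤ ∫⁻ z, ∑' k, (S k).indicator (fun _ => c k) z ∂ν := by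
        refine lintegral_mono_ae ?_
        filter_upwards [hf] with z ⟨k, hk, hle⟩
        refine hle.trans ?_
        refine le_trans ?_ (ENNReal.le_tsum k)
        simp [hk]
    _ = ∑' k, c k * ν (S k) := by
        rw [lintegral_tsum (fun k => (measurable_const.indicator (hS k)).aemeasurable)]
        exact tsum_congr fun k => lintegral_indicator_const (hS k) _
    _ ≤ ∑' k, ENNReal.ofReal (D * q ^ k) := ENNReal.tsum_le_tsum hc
    _ = ENNReal.ofReal (D * (1 - q)⁻¹) := by
        rw [← ENNReal.ofReal_tsum_of_nonneg (fun k => by positivity)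
          ((summable_geometric_of_lt_one hq hq1).mul_left D), tsum_mul_left,
          tsum_geometric_of_lt_one hq hq1]

/-- Local bound for a Riesz-type integral against a measure with the growth
`μ (ball x ρ) ≤ M ρ ^ γ`. -/
theorem lintegral_ball_rpow_le {μ : Measure E} {γ e M ρ : ℝ} {x : E} (hγ : 0 < γ) (he : 0 < e)
    (hM : 0 ≤ M) (hρ : 0 < ρ)
    (hμ : ∀ t, 0 < t → μ (ball x t) ≤ ENNReal.ofReal (M * t ^ γ)) :
    ∫⁻ z in ball x ρ, ENNReal.ofReal (‖x - z‖ ^ (e - γ)) ∂μ ≤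
      ENNReal.ofReal (2 ^ γ * M * ρ ^ e * (1 - 2 ^ (-e))⁻¹) := by
  have hx : μ {x} = 0 := by
    have hlim : Tendsto (fun t : ℝ => ENNReal.ofReal (M * t ^ γ)) (nhdsWithin 0 (Ioi 0))
        (nhds 0) := by
      have h1 : Tendsto (fun t : ℝ => M * t ^ γ) (nhdsWithin 0 (Ioi 0)) (nhds (M * 0 ^ γ)) :=
        (((Real.continuousAt_rpow_const 0 γ (Or.inr hγ.le)).tendsto).const_mul M).mono_left
          nhdsWithin_le_nhds
      have h2 := ENNReal.tendsto_ofReal h1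
      simpa [Real.zero_rpow hγ.ne'] using h2
    refine le_antisymm (ge_of_tendsto hlim ?_) zero_le
    filter_upwards [self_mem_nhdsWithin] with t ht
    exact (measure_mono (singleton_subset_iff.2 (mem_ball_self ht))).trans (hμ t ht)
  have hq1 : (2 : ℝ) ^ (-e) < 1 := Real.rpow_lt_one_of_one_lt_of_neg one_lt_two (by linarith)
  refine lintegral_le_of_geometric_cover (S := fun k => ball x (2 * ((1 / 2) ^ (k + 1) * ρ)))
    (c := fun k => ENNReal.ofReal
      ((2 * ((1 / 2) ^ (k + 1) * ρ)) ^ e * ((1 / 2) ^ (k + 1) * ρ) ^ (-γ)))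
    (by positivity) (by positivity) hq1 (fun k => measurableSet_ball) ?_ ?_
  · rw [ae_restrict_iff' measurableSet_ball]
    have : ∀ᵐ z ∂μ, z ≠ x := by
      rw [ae_iff]; simpa using hx
    filter_upwards [this] with z hz hzb
    have hd : 0 < ‖x - z‖ := norm_pos_iff.2 (sub_ne_zero.2 (Ne.symm hz))
    have hlt : ‖x - z‖ < ρ := by rwa [mem_ball, dist_comm, dist_eq_norm] at hzb
    obtain ⟨k, hk1, hk2⟩ := exists_nat_pow_near_of_lt_one (x := ‖x - z‖ / ρ) (y := 1 / 2)
      (by positivity) ((div_le_one hρ).2 hlt.le) (by norm_num) (by norm_num)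
    rw [lt_div_iff₀ hρ] at hk1
    rw [div_le_iff₀ hρ] at hk2
    have hpos : 0 < (1 / 2 : ℝ) ^ (k + 1) * ρ := by positivity
    have heq : 2 * ((1 / 2 : ℝ) ^ (k + 1) * ρ) = (1 / 2) ^ k * ρ := by ring
    rcases hk2.lt_or_eq with hk2 | hk2
    · refine ⟨k, ?_, ENNReal.ofReal_le_ofReal ?_⟩
      · rw [mem_ball, dist_comm, dist_eq_norm, heq]; exact hk2
      · rw [sub_eq_add_neg e γ, Real.rpow_add hd]
        refine mul_le_mul ?_ ?_ (by positivity) (by positivity)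
        · rw [heq]; exact Real.rpow_le_rpow hd.le hk2.le he.le
        · exact Real.rpow_le_rpow_of_nonpos hpos hk1.le (by linarith)
    · rcases k with _ | k
      · simp at hk2; exact absurd hk2 hlt.ne
      · have heq' : 2 * ((1 / 2 : ℝ) ^ (k + 1) * ρ) = (1 / 2) ^ k * ρ := by ring
        have hpos' : 0 < (1 / 2 : ℝ) ^ (k + 1) * ρ := by positivity
        refine ⟨k, ?_, ENNReal.ofReal_le_ofReal ?_⟩
        · rw [mem_ball, dist_comm, dist_eq_norm, hk2]; linarith
        · rw [sub_eq_add_neg e γ, Real.rpow_add hd]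
          refine mul_le_mul ?_ ?_ (by positivity) (by positivity)
          · exact Real.rpow_le_rpow hd.le (by linarith) he.le
          · rw [hk2]
  · intro k
    set d := (1 / 2 : ℝ) ^ (k + 1) * ρ with hd
    have hdpos : 0 < d := by positivity
    calc _ ≤ ENNReal.ofReal ((2 * d) ^ e * d ^ (-γ)) * ENNReal.ofReal (M * (2 * d) ^ γ) := by
          gcongr
          exact (Measure.restrict_apply_le _ _).trans (hμ _ (by positivity))
      _ = ENNReal.ofReal (2 ^ γ * M * ρ ^ e * (2 ^ (-e)) ^ k) := by
          rw [← ENNReal.ofReal_mul (by positivity)]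
          congr 1
          have h2d : 2 * d = (1 / 2) ^ k * ρ := by rw [hd]; ring
          have h1 : (2 * d) ^ e = (2 ^ (-e)) ^ k * ρ ^ e := by
            rw [h2d, Real.mul_rpow (by positivity) hρ.le, ← Real.rpow_natCast, ← Real.rpow_mul
              (by norm_num), ← Real.rpow_natCast, ← Real.rpow_mul (by norm_num), one_div,
              Real.inv_rpow (by norm_num), ← Real.rpow_neg (by norm_num)]
            ring_nf
          rw [h1, Real.mul_rpow (by norm_num) hdpos.le, Real.rpow_neg hdpos.le]
          field_simp

/-- Decay bound at infinity for a measure with the growth `μ (ball 0 ρ) ≤ M ρ ^ γ`. -/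
theorem lintegral_one_add_norm_rpow_le {μ : Measure E} {γ e M : ℝ} (hγ : 0 < γ) (he : 0 < e)
    (hM : 0 ≤ M)
    (hμ : ∀ t, 0 < t → μ (ball 0 t) ≤ ENNReal.ofReal (M * t ^ γ)) :
    ∫⁻ z, ENNReal.ofReal ((1 + ‖z‖) ^ (-(γ + e))) ∂μ ≤
      ENNReal.ofReal (2 ^ γ * M * (1 - 2 ^ (-e))⁻¹) := by
  have hq1 : (2 : ℝ) ^ (-e) < 1 := Real.rpow_lt_one_of_one_lt_of_neg one_lt_two (by linarith)
  refine lintegral_le_of_geometric_cover (S := fun k => ball 0 (2 * 2 ^ k))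
    (c := fun k => ENNReal.ofReal (((2 : ℝ) ^ k) ^ (-(γ + e))))
    (by positivity) (by positivity) hq1 (fun k => measurableSet_ball) ?_ ?_
  · refine Eventually.of_forall fun z => ?_
    obtain ⟨k, hk1, hk2⟩ := exists_nat_pow_near (x := 1 + ‖z‖) (y := 2)
      (by linarith [norm_nonneg z]) (by norm_num)
    refine ⟨k, ?_, ENNReal.ofReal_le_ofReal ?_⟩
    · rw [mem_ball_zero_iff]; rw [pow_succ] at hk2; linarith
    · exact Real.rpow_le_rpow_of_nonpos (by positivity) hk1 (by linarith)
  · intro k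
    set d := (2 : ℝ) ^ k with hd
    have hdpos : 0 < d := by positivity
    calc _ ≤ ENNReal.ofReal (d ^ (-(γ + e))) * ENNReal.ofReal (M * (2 * d) ^ γ) := by
          gcongr
          exact hμ _ (by positivity)
      _ = ENNReal.ofReal (2 ^ γ * M * (2 ^ (-e)) ^ k) := by
          rw [← ENNReal.ofReal_mul (by positivity)]
          congr 1
          have h1 : ((2 : ℝ) ^ (-e)) ^ k = d ^ (-e) := by
            rw [hd, ← Real.rpow_natCast, ← Real.rpow_natCast, ← Real.rpow_mul (by norm_num),
              ← Real.rpow_mul (by norm_num), mul_comm]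
          rw [h1, neg_add, Real.rpow_add hdpos, Real.mul_rpow (by norm_num) hdpos.le,
            Real.rpow_neg hdpos.le γ]
          field_simp

end DyadicSums

section RieszPotential

theorem ENNReal.add_sq_le_two_mul (a b : ENNReal) : (a + b) ^ 2 ≤ 2 * (a ^ 2 + b ^ 2) := by
  have h := ENNReal.rpow_add_le_mul_rpow_add_rpow a b (p := 2) one_le_two
  norm_num at h
  exact h

/-- Cauchy–Schwarz for the lower Lebesgue integral. -/
theorem sq_lintegral_mul_le {Y : Type*} [MeasurableSpace Y] {ν : Measure Y} {f g : Y → ENNReal}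
    (hf : AEMeasurable f ν) (hg : AEMeasurable g ν) :
    (∫⁻ z, f z * g z ∂ν) ^ 2 ≤ (∫⁻ z, f z ^ 2 ∂ν) * ∫⁻ z, g z ^ 2 ∂ν := by
  have h := ENNReal.lintegral_mul_le_Lp_mul_Lq ν Real.HolderConjugate.two_two hf hg
  have h2 := pow_le_pow_left' h 2
  simp only [Pi.mul_apply, mul_pow, ← ENNReal.rpow_mul_natCast] at h2
  norm_num at h2
  exact h2

theorem abs_rpow_neg_sub_rpow_neg_le {a b γ : ℝ} (hγ : 0 < γ) (ha : 0 < a) (hab : a ≤ b) :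
    |a ^ (-γ) - b ^ (-γ)| ≤ (γ + 1) * (b - a) * a ^ (-(γ + 1)) := by
  have hb : 0 < b := ha.trans_le hab
  have h := Convex.norm_image_sub_le_of_norm_deriv_le (f := fun t : ℝ => t ^ (-γ))
    (s := Icc a b) (x := b) (y := a) (C := (γ + 1) * a ^ (-(γ + 1)))
    (fun t ht => (Real.hasDerivAt_rpow_const (Or.inl (ha.trans_le ht.1).ne')).differentiableAt)
    (fun t ht => by
      have ht0 : 0 < t := ha.trans_le ht.1
      rw [Real.deriv_rpow_const, Real.norm_eq_abs, abs_mul, abs_neg, abs_of_pos hγ,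
        abs_of_nonneg (by positivity)]
      refine mul_le_mul (by linarith) ?_ (by positivity) (by positivity)
      rw [show -γ - 1 = -(γ + 1) by ring]
      exact Real.rpow_le_rpow_of_nonpos ha ht.1 (by linarith))
    (convex_Icc a b) (right_mem_Icc.2 hab) (left_mem_Icc.2 hab)
  simp only [Real.norm_eq_abs] at h
  rw [abs_sub_comm a b, abs_of_nonneg (sub_nonneg.2 hab)] at h
  linarith

variable {n : ℕ}

/-- The normalised Riesz kernel is controlled by its singular part in a ball comparable with
`1 + ‖x‖` and by a decaying tail. -/
theorem abs_riesz_kernel_sub_le {γ : ℝ} (hγ : 0 < γ) (x z : En n) :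
    |1 / ‖x - z‖ ^ γ - 1 / (1 + ‖z‖) ^ γ| ≤
      (ball x (2 * (1 + ‖x‖))).indicator (fun z => ‖x - z‖ ^ (-γ)) z +
        (3 + (γ + 1) * 2 ^ (γ + 1)) * (1 + ‖x‖) * (1 + ‖z‖) ^ (-(γ + 1)) := by
  have hz : 0 < 1 + ‖z‖ := by positivity
  have hx : 0 < 1 + ‖x‖ := by positivity
  have hzpos : 0 < (1 + ‖z‖) ^ (-(γ + 1)) := by positivity
  have htri : ‖z‖ ≤ ‖x‖ + ‖x - z‖ := by
    simpa using norm_sub_le x (x - z)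
  have htri' : ‖x - z‖ ≤ ‖x‖ + ‖z‖ := norm_sub_le x z
  rw [one_div, one_div, ← Real.rpow_neg (norm_nonneg _), ← Real.rpow_neg hz.le]
  by_cases h : z ∈ ball x (2 * (1 + ‖x‖))
  · rw [indicator_of_mem h]
    rw [mem_ball, dist_comm, dist_eq_norm] at h
    have h1 : (1 + ‖z‖) ^ (-γ) ≤ 3 * (1 + ‖x‖) * (1 + ‖z‖) ^ (-(γ + 1)) := by
      rw [show -γ = 1 + -(γ + 1) by ring, Real.rpow_add hz, Real.rpow_one]
      gcongr
      linarith
    have h2 : 0 ≤ ‖x - z‖ ^ (-γ) := by positivity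
    have h3 : 0 ≤ (1 + ‖z‖) ^ (-γ) := by positivity
    have h4 : 0 ≤ (γ + 1) * 2 ^ (γ + 1) * (1 + ‖x‖) * (1 + ‖z‖) ^ (-(γ + 1)) := by positivity
    rw [abs_le]
    constructor <;> nlinarith
  · rw [indicator_of_notMem h, zero_add]
    rw [mem_ball, dist_comm, dist_eq_norm, not_lt] at h
    have hmin : ∀ a, (1 + ‖z‖) / 2 ≤ a → a ^ (-(γ + 1)) ≤ 2 ^ (γ + 1) * (1 + ‖z‖) ^ (-(γ + 1)) := by
      intro a ha
      refine (Real.rpow_le_rpow_of_nonpos (by positivity) ha (by linarith)).trans_eq ?_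
      rw [div_eq_mul_inv, Real.mul_rpow hz.le (by norm_num), Real.inv_rpow (by norm_num),
        ← Real.rpow_neg (by norm_num), neg_neg, mul_comm]
    have hd : 0 < ‖x - z‖ := by linarith
    have hfin : |‖x - z‖ ^ (-γ) - (1 + ‖z‖) ^ (-γ)| ≤
        (γ + 1) * (1 + ‖x‖) * (2 ^ (γ + 1) * (1 + ‖z‖) ^ (-(γ + 1))) := by
      rcases le_total ‖x - z‖ (1 + ‖z‖) with hle | hle
      · refine (abs_rpow_neg_sub_rpow_neg_le hγ hd hle).trans ?_
        refine mul_le_mul ?_ (hmin _ (by linarith)) (by positivity) (by positivity)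
        refine mul_le_mul_of_nonneg_left (by linarith) (by linarith)
      · rw [abs_sub_comm]
        refine (abs_rpow_neg_sub_rpow_neg_le hγ hz hle).trans ?_
        refine mul_le_mul ?_ (hmin _ (by linarith)) (by positivity) (by positivity)
        refine mul_le_mul_of_nonneg_left (by linarith) (by linarith)
    have h4 : 0 ≤ 3 * (1 + ‖x‖) * (1 + ‖z‖) ^ (-(γ + 1)) := by positivity
    nlinarith

/-- The potential of the absolute normalised Riesz kernel against a measure. -/
def absPot (n : ℕ) (γ : ℝ) (μ : Measure (En n)) (x : En n) : ENNReal :=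
  ∫⁻ z, ENNReal.ofReal |1 / ‖x - z‖ ^ γ - 1 / (1 + ‖z‖) ^ γ| ∂μ

theorem measurable_absPot (γ : ℝ) (μ : Measure (En n)) [SFinite μ] :
    Measurable (absPot n γ μ) := by
  refine Measurable.lintegral_prod_right'
    (f := fun p : En n × En n =>
      ENNReal.ofReal |1 / ‖p.1 - p.2‖ ^ γ - 1 / (1 + ‖p.2‖) ^ γ|) ?_
  fun_prop

theorem volume_ball_le (x : En n) {t : ℝ} (ht : 0 < t) :
    volume (ball x t) ≤ ENNReal.ofReal ((volume (ball (0 : En n) 1)).toReal * t ^ (n : ℝ)) := by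
  rw [Measure.addHaar_ball_of_pos volume x ht, ENNReal.ofReal_mul ENNReal.toReal_nonneg,
    ENNReal.ofReal_toReal measure_ball_lt_top.ne, mul_comm]
  simp

/-- Square of the potential, by Cauchy–Schwarz with the weight `‖x - z‖`. -/
theorem absPot_sq_le {γ M : ℝ} (hγ : 0 < γ) (hM : 0 ≤ M) :
    ∃ C : ENNReal, C ≠ ⊤ ∧ ∀ μ : Measure (En n),
      (∀ x t, 0 < t → μ (ball x t) ≤ ENNReal.ofReal (M * t ^ γ)) → ∀ x,
      absPot n γ μ x ^ 2 ≤ C * (ENNReal.ofReal (1 + ‖x‖) *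
        (∫⁻ z in ball x (2 * (1 + ‖x‖)), ENNReal.ofReal (‖x - z‖ ^ (-(γ + 1))) ∂μ) +
          ENNReal.ofReal ((1 + ‖x‖) ^ 2)) := by
  set c₁ : ℝ := 2 ^ γ * M * (1 - 2 ^ (-(1 : ℝ)))⁻¹
  set c₂ : ℝ := 3 + (γ + 1) * 2 ^ (γ + 1) with hc₂
  have hc₁ : 0 ≤ c₁ := by
    have : (0 : ℝ) ≤ (1 - 2 ^ (-(1 : ℝ)))⁻¹ := by norm_num
    positivity
  have hc₂0 : 0 ≤ c₂ := by positivity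
  refine ⟨2 * (ENNReal.ofReal (2 * c₁) + ENNReal.ofReal ((c₂ * c₁) ^ 2)), by finiteness, ?_⟩
  intro μ hμ x
  have hx : 0 < 1 + ‖x‖ := by positivity
  have hF : ∫⁻ z, ENNReal.ofReal ((1 + ‖z‖) ^ (-(γ + 1))) ∂μ ≤ ENNReal.ofReal c₁ :=
    lintegral_one_add_norm_rpow_le hγ one_pos hM (hμ 0)
  set N := ∫⁻ z in ball x (2 * (1 + ‖x‖)), ENNReal.ofReal (‖x - z‖ ^ (-γ)) ∂μ with hN
  set I := ∫⁻ z in ball x (2 * (1 + ‖x‖)), ENNReal.ofReal (‖x - z‖ ^ (-(γ + 1))) ∂μ with hI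
  have hW : absPot n γ μ x ≤ N + ENNReal.ofReal (c₂ * c₁ * (1 + ‖x‖)) := by
    calc absPot n γ μ x ≤ ∫⁻ z, ((ball x (2 * (1 + ‖x‖))).indicator
            (fun z => ENNReal.ofReal (‖x - z‖ ^ (-γ))) z +
            ENNReal.ofReal (c₂ * (1 + ‖x‖)) * ENNReal.ofReal ((1 + ‖z‖) ^ (-(γ + 1)))) ∂μ := by
          refine lintegral_mono fun z => ?_
          refine (ENNReal.ofReal_le_ofReal (abs_riesz_kernel_sub_le hγ x z)).trans ?_
          refine ENNReal.ofReal_add_le.trans ?_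
          refine add_le_add (le_of_eq ?_) (le_of_eq ?_)
          · by_cases h : z ∈ ball x (2 * (1 + ‖x‖)) <;> simp [h]
          · rw [ENNReal.ofReal_mul (by positivity)]
      _ = N + ENNReal.ofReal (c₂ * (1 + ‖x‖)) *
            ∫⁻ z, ENNReal.ofReal ((1 + ‖z‖) ^ (-(γ + 1))) ∂μ := by
          rw [lintegral_add_right _ (by fun_prop), lintegral_indicator measurableSet_ball,
            lintegral_const_mul _ (by fun_prop)]
      _ ≤ N + ENNReal.ofReal (c₂ * (1 + ‖x‖)) * ENNReal.ofReal c₁ := by gcongr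
      _ = _ := by
          rw [← ENNReal.ofReal_mul (by positivity)]; ring_nf
  have hN2 : N ^ 2 ≤ ENNReal.ofReal (2 * c₁) * (ENNReal.ofReal (1 + ‖x‖) * I) := by
    have hcs := sq_lintegral_mul_le (ν := μ.restrict (ball x (2 * (1 + ‖x‖))))
      (f := fun z => ENNReal.ofReal (‖x - z‖ ^ ((1 - γ) / 2)))
      (g := fun z => ENNReal.ofReal (‖x - z‖ ^ (-(γ + 1) / 2)))
      (by fun_prop) (by fun_prop)
    have hsq : ∀ (p : ℝ) (z : En n), ENNReal.ofReal (‖x - z‖ ^ (p / 2)) ^ 2 =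
        ENNReal.ofReal (‖x - z‖ ^ p) := by
      intro p z
      rw [← ENNReal.ofReal_pow (by positivity), ← Real.rpow_mul_natCast (norm_nonneg _)]
      norm_num
    simp only [hsq] at hcs
    have h1 : N ≤ ∫⁻ z in ball x (2 * (1 + ‖x‖)), ENNReal.ofReal (‖x - z‖ ^ ((1 - γ) / 2)) *
        ENNReal.ofReal (‖x - z‖ ^ (-(γ + 1) / 2)) ∂μ := by
      refine lintegral_mono fun z => ?_
      rw [← ENNReal.ofReal_mul (by positivity)]
      refine ENNReal.ofReal_le_ofReal (le_of_eq ?_)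
      rw [← Real.rpow_add' (norm_nonneg _) (by linarith)]
      ring_nf
    have h2 := lintegral_ball_rpow_le (x := x) (e := 1) (ρ := 2 * (1 + ‖x‖)) hγ one_pos hM
      (by positivity) (hμ x)
    refine (pow_le_pow_left' h1 2).trans (hcs.trans ?_)
    rw [← mul_assoc, ← ENNReal.ofReal_mul (by positivity)]
    refine mul_le_mul_left (h2.trans (le_of_eq ?_)) _
    congr 1
    rw [Real.rpow_one]; ring
  calc absPot n γ μ x ^ 2 ≤ (N + ENNReal.ofReal (c₂ * c₁ * (1 + ‖x‖))) ^ 2 := pow_le_pow_left' hW 2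
    _ ≤ 2 * (N ^ 2 + ENNReal.ofReal (c₂ * c₁ * (1 + ‖x‖)) ^ 2) := ENNReal.add_sq_le_two_mul _ _
    _ ≤ 2 * (ENNReal.ofReal (2 * c₁) * (ENNReal.ofReal (1 + ‖x‖) * I) +
          ENNReal.ofReal ((c₂ * c₁) ^ 2) * ENNReal.ofReal ((1 + ‖x‖) ^ 2)) := by
        gcongr
        rw [← ENNReal.ofReal_pow (by positivity), mul_pow, ENNReal.ofReal_mul (by positivity)]
    _ ≤ 2 * ((ENNReal.ofReal (2 * c₁) + ENNReal.ofReal ((c₂ * c₁) ^ 2)) *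
          (ENNReal.ofReal (1 + ‖x‖) * I) +
          (ENNReal.ofReal (2 * c₁) + ENNReal.ofReal ((c₂ * c₁) ^ 2)) *
            ENNReal.ofReal ((1 + ‖x‖) ^ 2)) := by
        gcongr
        · exact le_self_add
        · exact le_add_self
    _ = _ := by rw [← mul_add, mul_assoc]

/-- Weighted `L²` bound for the potential of a measure of Morrey growth `n - 2s`. -/
theorem lintegral_absPot_sq_le {s M : ℝ} (hs : 1 < s) (hn : 2 * s < n) (hM : 0 ≤ M) :
    ∃ C : ENNReal, C ≠ ⊤ ∧ ∀ μ : Measure (En n), SFinite μ →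
      (∀ x t, 0 < t → μ (ball x t) ≤ ENNReal.ofReal (M * t ^ ((n : ℝ) - 2 * s))) →
      ∫⁻ x, absPot n ((n : ℝ) - 2 * s) μ x ^ 2 *
        ENNReal.ofReal ((1 + ‖x‖) ^ (-((n : ℝ) + 2 * s))) ≤ C := by
  set γ : ℝ := (n : ℝ) - 2 * s with hγdef
  have hγ : 0 < γ := by linarith
  obtain ⟨C, hC, hsq⟩ := absPot_sq_le (n := n) hγ hM
  set c₁ : ℝ := 2 ^ γ * M * (1 - 2 ^ (-(1 : ℝ)))⁻¹ with hc₁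
  set J : ENNReal := ∫⁻ h : En n, ENNReal.ofReal (‖h‖ ^ (-(γ + 1))) *
    ENNReal.ofReal ((1 + ‖h‖) ^ (-(4 * s - 2))) with hJ
  set T : ENNReal := ∫⁻ x : En n, ENNReal.ofReal ((1 + ‖x‖) ^ (-((n : ℝ) + 2 * s - 2))) with hT
  have hTfin : T ≠ ⊤ := by
    refine (finite_integral_one_add_norm ?_).ne
    rw [finrank_euclideanSpace_fin]; linarith
  have hJfin : J ≠ ⊤ := by
    rw [hJ, ← lintegral_add_compl _ (measurableSet_ball (x := (0 : En n)) (ε := 1))]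
    refine ENNReal.add_ne_top.2 ⟨?_, ?_⟩
    · have h := lintegral_ball_rpow_le (μ := (volume : Measure (En n))) (x := 0) (γ := n)
        (e := 2 * s - 1) (ρ := 1) (by linarith) (by linarith) ENNReal.toReal_nonneg one_pos
        (fun t ht => volume_ball_le 0 ht)
      refine ne_top_of_le_ne_top ENNReal.ofReal_ne_top (le_trans ?_ h)
      refine lintegral_mono fun z => ?_
      rw [← ENNReal.ofReal_mul (by positivity), zero_sub, norm_neg]
      refine ENNReal.ofReal_le_ofReal ?_
      rw [show 2 * s - 1 - (n : ℝ) = -(γ + 1) by rw [hγdef]; ring]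
      refine mul_le_of_le_one_right (by positivity) ?_
      exact Real.rpow_le_one_of_one_le_of_nonpos (by linarith [norm_nonneg z]) (by linarith)
    · have h : ∫⁻ x : En n, ENNReal.ofReal (2 ^ (γ + 1)) *
          ENNReal.ofReal ((1 + ‖x‖) ^ (-((n : ℝ) + 2 * s - 1))) ≠ ⊤ := by
        rw [lintegral_const_mul _ (by fun_prop)]
        refine ENNReal.mul_ne_top ENNReal.ofReal_ne_top (finite_integral_one_add_norm ?_).ne
        rw [finrank_euclideanSpace_fin]; linarith
      refine ne_top_of_le_ne_top h (le_trans ?_ (setLIntegral_le_lintegral (ball 0 1)ᶜ _))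
      refine setLIntegral_mono' measurableSet_ball.compl fun z hz => ?_
      rw [mem_compl_iff, mem_ball_zero_iff, not_lt] at hz
      rw [← ENNReal.ofReal_mul (by positivity), ← ENNReal.ofReal_mul (by positivity)]
      refine ENNReal.ofReal_le_ofReal ?_
      have h0 : 0 < 1 + ‖z‖ := by positivity
      rw [show -((n : ℝ) + 2 * s - 1) = -(γ + 1) + -(4 * s - 2) by rw [hγdef]; ring,
        Real.rpow_add h0, ← mul_assoc]
      refine mul_le_mul_of_nonneg_right ?_ (by positivity)
      calc ‖z‖ ^ (-(γ + 1)) ≤ ((1 + ‖z‖) * 2⁻¹) ^ (-(γ + 1)) :=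
            Real.rpow_le_rpow_of_nonpos (by positivity) (by linarith) (by linarith)
        _ = 2 ^ (γ + 1) * (1 + ‖z‖) ^ (-(γ + 1)) := by
            rw [Real.mul_rpow h0.le (by norm_num), Real.inv_rpow (by norm_num),
              ← Real.rpow_neg (by norm_num), neg_neg, mul_comm]
  refine ⟨C * (ENNReal.ofReal (3 ^ ((n : ℝ) + 2 * s - 1)) * (ENNReal.ofReal c₁ * J) + T),
    by finiteness, ?_⟩
  intro μ hsf hμ
  have hF : ∫⁻ z, ENNReal.ofReal ((1 + ‖z‖) ^ (-(γ + 1))) ∂μ ≤ ENNReal.ofReal c₁ :=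
    lintegral_one_add_norm_rpow_le hγ one_pos hM (hμ 0)
  set G : En n → En n → ENNReal := fun x z => ENNReal.ofReal ((1 + ‖z‖) ^ (-(γ + 1))) *
    (ENNReal.ofReal (‖x - z‖ ^ (-(γ + 1))) *
      ENNReal.ofReal ((1 + ‖x - z‖) ^ (-(4 * s - 2)))) with hG
  have hGm : Measurable (Function.uncurry G) := by
    simp only [hG, Function.uncurry_def]; fun_prop
  have hkey : ∀ x : En n, absPot n γ μ x ^ 2 * ENNReal.ofReal ((1 + ‖x‖) ^ (-((n : ℝ) + 2 * s))) ≤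
      C * (ENNReal.ofReal (3 ^ ((n : ℝ) + 2 * s - 1)) * (∫⁻ z, G x z ∂μ) +
        ENNReal.ofReal ((1 + ‖x‖) ^ (-((n : ℝ) + 2 * s - 2)))) := by
    intro x
    have hx : 0 < 1 + ‖x‖ := by positivity
    refine (mul_le_mul_left (hsq μ hμ x) _).trans ?_
    rw [mul_assoc, add_mul]
    refine mul_le_mul_right (add_le_add ?_ (le_of_eq ?_)) _
    · rw [mul_right_comm, ← ENNReal.ofReal_mul hx.le,
        ← lintegral_const_mul _ (by fun_prop),
        ← lintegral_const_mul _ (hGm.of_uncurry_left)]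
      refine le_trans ?_ (setLIntegral_le_lintegral (ball x (2 * (1 + ‖x‖))) _)
      refine setLIntegral_mono' measurableSet_ball fun z hz => ?_
      rw [mem_ball, dist_comm, dist_eq_norm] at hz
      have htri : ‖z‖ ≤ ‖x‖ + ‖x - z‖ := by simpa using norm_sub_le x (x - z)
      simp only [hG]
      rw [← ENNReal.ofReal_mul (by positivity), ← ENNReal.ofReal_mul (by positivity),
        ← ENNReal.ofReal_mul (by positivity), ← ENNReal.ofReal_mul (by positivity)]
      refine ENNReal.ofReal_le_ofReal ?_
      have hpow : ∀ p b : ℝ, 0 ≤ p → 0 < b → b ≤ 3 * (1 + ‖x‖) →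
          (1 + ‖x‖) ^ (-p) ≤ 3 ^ p * b ^ (-p) := by
        intro p b hp hb hle
        calc (1 + ‖x‖) ^ (-p) ≤ (b * 3⁻¹) ^ (-p) :=
              Real.rpow_le_rpow_of_nonpos (by positivity) (by linarith) (by linarith)
          _ = 3 ^ p * b ^ (-p) := by
              rw [Real.mul_rpow hb.le (by norm_num), Real.inv_rpow (by norm_num),
                ← Real.rpow_neg (by norm_num), neg_neg, mul_comm]
      have e1 : (1 + ‖x‖) * (1 + ‖x‖) ^ (-((n : ℝ) + 2 * s)) =
          (1 + ‖x‖) ^ (-(γ + 1)) * (1 + ‖x‖) ^ (-(4 * s - 2)) := by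
        rw [← Real.rpow_one_add' hx.le (by linarith), ← Real.rpow_add hx]
        congr 1; rw [hγdef]; ring
      have e2 : (3 : ℝ) ^ ((n : ℝ) + 2 * s - 1) = 3 ^ (γ + 1) * 3 ^ (4 * s - 2) := by
        rw [← Real.rpow_add (by norm_num)]
        congr 1; rw [hγdef]; ring
      have i1 := hpow (γ + 1) (1 + ‖z‖) (by linarith) (by positivity) (by linarith)
      have i2 := hpow (4 * s - 2) (1 + ‖x - z‖) (by linarith) (by positivity)
        (by linarith [norm_nonneg x])
      rw [e1, e2]
      calc _ ≤ (3 ^ (γ + 1) * (1 + ‖z‖) ^ (-(γ + 1))) *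
            (3 ^ (4 * s - 2) * (1 + ‖x - z‖) ^ (-(4 * s - 2))) * ‖x - z‖ ^ (-(γ + 1)) := by
            gcongr
        _ = _ := by ring
    · rw [← ENNReal.ofReal_mul (by positivity), ← Real.rpow_two, ← Real.rpow_add hx]
      congr 2; ring
  calc _ ≤ ∫⁻ x : En n, C * (ENNReal.ofReal (3 ^ ((n : ℝ) + 2 * s - 1)) * (∫⁻ z, G x z ∂μ) +
        ENNReal.ofReal ((1 + ‖x‖) ^ (-((n : ℝ) + 2 * s - 2)))) := lintegral_mono hkey
    _ = C * (ENNReal.ofReal (3 ^ ((n : ℝ) + 2 * s - 1)) * (∫⁻ x : En n, ∫⁻ z, G x z ∂μ) + T) := by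
        rw [lintegral_const_mul' _ _ hC, lintegral_add_right _ (by fun_prop),
          lintegral_const_mul' _ _ ENNReal.ofReal_ne_top]
    _ ≤ _ := by
        gcongr
        rw [lintegral_lintegral_swap hGm.aemeasurable]
        have : ∀ z, ∫⁻ x : En n, G x z = ENNReal.ofReal ((1 + ‖z‖) ^ (-(γ + 1))) * J := by
          intro z
          rw [lintegral_const_mul' _ _ ENNReal.ofReal_ne_top]
          congr 1
          exact lintegral_sub_right_eq_self (fun h : En n => ENNReal.ofReal (‖h‖ ^ (-(γ + 1))) *
            ENNReal.ofReal ((1 + ‖h‖) ^ (-(4 * s - 2)))) z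
        simp only [this]
        rw [lintegral_mul_const' _ _ hJfin]
        gcongr

end RieszPotential

section PoissonKernel

variable {n : ℕ}

theorem lintegral_eq_mul_lintegral_comp_smul {f : En n → ENNReal} (hf : Measurable f) {R : ℝ}
    (hR : 0 < R) :
    ∫⁻ x, f x = ENNReal.ofReal (R ^ n) * ∫⁻ x, f (R • x) := by
  have h := Measure.map_addHaar_smul (volume : Measure (En n)) hR.ne'
  have h2 : ∫⁻ x, f (R • x) = ENNReal.ofReal ((R ^ n)⁻¹) * ∫⁻ x, f x := by
    rw [← lintegral_map (g := fun x : En n => R • x) hf (by fun_prop), h, lintegral_smul_measure,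
      finrank_euclideanSpace_fin, abs_of_pos (by positivity), smul_eq_mul]
  rw [h2, ← mul_assoc, ← ENNReal.ofReal_mul (by positivity), mul_inv_cancel₀ (by positivity),
    ENNReal.ofReal_one, one_mul]

theorem continuous_projx : Continuous (projx n) := by
  unfold projx
  fun_prop

/-- The inclusion of `ℝ^n` as the boundary of the upper half-space. -/
def bdryIncl (n : ℕ) (z : En n) : E1 n :=
  (EuclideanSpace.equiv (Fin (n + 1)) ℝ).symm (Fin.snoc (fun i => z i) 0)

theorem norm_sub_bdryIncl_sq (X : E1 n) (z : En n) :
    ‖bdryIncl n z - X‖ ^ 2 = ‖projx n X - z‖ ^ 2 + X (Fin.last n) ^ 2 := by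
  rw [EuclideanSpace.norm_sq_eq, EuclideanSpace.norm_sq_eq, Fin.sum_univ_castSucc]
  simp [bdryIncl, projx, abs_sub_comm]

theorem norm_bdryIncl (z : En n) : ‖bdryIncl n z‖ = ‖z‖ := by
  rw [← sq_eq_sq₀ (norm_nonneg _) (norm_nonneg _), EuclideanSpace.norm_sq_eq,
    EuclideanSpace.norm_sq_eq, Fin.sum_univ_castSucc]
  simp [bdryIncl]

theorem norm_projx_le (X : E1 n) : ‖projx n X‖ ≤ ‖X‖ := by
  refine le_of_sq_le_sq ?_ (norm_nonneg _)
  rw [EuclideanSpace.norm_sq_eq, EuclideanSpace.norm_sq_eq, Fin.sum_univ_castSucc]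
  simp only [projx]
  refine le_add_of_le_of_nonneg (le_of_eq ?_) (by positivity)
  simp

/-- The normalising constant of the Poisson kernel. -/
def kPs (n : ℕ) (s : ℝ) : ℝ :=
  Real.Gamma ((n : ℝ) / 2 + s) / (Real.Gamma s * Real.pi ^ ((n : ℝ) / 2))

theorem kPs_nonneg {s : ℝ} (hs : 0 < s) : 0 ≤ kPs n s := by
  have h1 := (Real.Gamma_pos_of_pos hs).le
  have h2 : 0 ≤ Real.Gamma ((n : ℝ) / 2 + s) := (Real.Gamma_pos_of_pos (by positivity)).le
  unfold kPs
  positivity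

theorem Ps_nonneg {s : ℝ} (hs : 0 < s) (x : En n) {y : ℝ} (hy : 0 ≤ y) : 0 ≤ Ps n s x y := by
  have h := kPs_nonneg (n := n) hs
  unfold kPs at h
  unfold Ps
  positivity

theorem measurable_Ps (s : ℝ) : Measurable fun p : En n × ℝ => Ps n s p.1 p.2 := by
  unfold Ps
  fun_prop

theorem Ps_smul {s y : ℝ} (hy : 0 < y) (x : En n) :
    Ps n s (y • x) y = (y ^ n)⁻¹ * Ps n s x 1 := by
  unfold Ps
  have h : ‖y • x‖ ^ 2 + y ^ 2 = y ^ 2 * (‖x‖ ^ 2 + 1 ^ 2) := by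
    rw [norm_smul, Real.norm_eq_abs, abs_of_pos hy]; ring
  have h2 : (y ^ 2) ^ ((n : ℝ) / 2 + s) = y ^ n * y ^ (2 * s) := by
    rw [← Real.rpow_natCast, ← Real.rpow_natCast, ← Real.rpow_mul hy.le, ← Real.rpow_add hy]
    congr 1; push_cast; ring
  rw [h, Real.mul_rpow (by positivity) (by positivity), h2, Real.one_rpow]
  have : 0 < y ^ (2 * s) := by positivity
  field_simp

/-- The mass of the Poisson kernel is finite and independent of the height. -/
theorem exists_lintegral_Ps_le {s : ℝ} (hs : 0 < s) :
    ∃ C : ENNReal, C ≠ ⊤ ∧ ∀ (x : En n) (y : ℝ), 0 < y →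
      ∫⁻ z, ENNReal.ofReal (Ps n s (x - z) y) ≤ C := by
  refine ⟨∫⁻ h, ENNReal.ofReal (Ps n s h 1), ?_, fun x y hy => ?_⟩
  · have hi : Integrable (fun h : En n => (1 + ‖h‖ ^ 2) ^ (-((n : ℝ) + 2 * s) / 2)) := by
      refine integrable_rpow_neg_one_add_norm_sq ?_
      rw [finrank_euclideanSpace_fin]; linarith
    have hi2 := (hi.const_mul (kPs n s)).lintegral_lt_top
    refine ne_top_of_le_ne_top hi2.ne (lintegral_mono fun h => ENNReal.ofReal_le_ofReal ?_)
    refine le_of_eq ?_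
    unfold Ps
    rw [Real.one_rpow, mul_one, one_pow, div_eq_mul_inv, ← Real.rpow_neg (by positivity), kPs,
      add_comm (‖h‖ ^ 2)]
    congr 2; ring
  · have hm : Measurable fun h : En n => ENNReal.ofReal (Ps n s h y) := by
      refine ((measurable_Ps s).comp (f := fun h : En n => (h, y)) (by fun_prop)).ennreal_ofReal
    rw [lintegral_sub_left_eq_self (fun h : En n => ENNReal.ofReal (Ps n s h y)) x,
      lintegral_eq_mul_lintegral_comp_smul hm hy,
      ← lintegral_const_mul' _ _ ENNReal.ofReal_ne_top]
    refine lintegral_mono fun h => ?_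
    rw [← ENNReal.ofReal_mul (by positivity), Ps_smul hy, ← mul_assoc,
      mul_inv_cancel₀ (by positivity), one_mul]

theorem rpow_mul_Ps {s : ℝ} {X : E1 n} (hX : 0 < X (Fin.last n)) (z : En n) :
    X (Fin.last n) ^ (3 - 2 * s) * Ps n s (projx n X - z) (X (Fin.last n)) =
      kPs n s * X (Fin.last n) ^ 3 * ‖bdryIncl n z - X‖ ^ (-((n : ℝ) + 2 * s)) := by
  unfold Ps
  rw [← norm_sub_bdryIncl_sq, ← Real.rpow_natCast ‖bdryIncl n z - X‖ 2,
    ← Real.rpow_mul (norm_nonneg _), Real.rpow_neg (norm_nonneg _),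
    show ((2 : ℕ) : ℝ) * ((n : ℝ) / 2 + s) = (n : ℝ) + 2 * s by push_cast; ring,
    show X (Fin.last n) ^ 3 = X (Fin.last n) ^ (3 - 2 * s) * X (Fin.last n) ^ (2 * s) by
      rw [← Real.rpow_add hX, ← Real.rpow_natCast]; norm_num, kPs, div_eq_mul_inv]
  ring

/-- The upper half of the ball of radius `r`. -/
def upperHalfBall (n : ℕ) (r : ℝ) : Set (E1 n) :=
  {X : E1 n | 0 < X (Fin.last n)} ∩ Metric.ball (0 : E1 n) r

theorem measurableSet_upperHalfBall (r : ℝ) : MeasurableSet (upperHalfBall n r) := by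
  refine MeasurableSet.inter ?_ measurableSet_ball
  exact measurableSet_lt measurable_const (by fun_prop)

/-- Weighted mass of the Poisson kernel over a half-ball, with its decay in the boundary point. -/
theorem exists_lintegral_upperHalfBall_Ps_le {s r : ℝ} (hs : 0 < s) (hs2 : s < 2) (hr : 1 ≤ r) :
    ∃ C : ENNReal, C ≠ ⊤ ∧ ∀ z : En n,
      ∫⁻ X in upperHalfBall n r, ENNReal.ofReal
        (X (Fin.last n) ^ (3 - 2 * s) * Ps n s (projx n X - z) (X (Fin.last n))) ≤
      C * ENNReal.ofReal ((1 + ‖z‖) ^ (-((n : ℝ) + 2 * s))) := by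
  have hk := kPs_nonneg (n := n) hs
  have hp : 0 ≤ (n : ℝ) + 2 * s := by positivity
  set p : ℝ := (n : ℝ) + 2 * s with hpdef
  set V : ℝ := (volume (ball (0 : E1 n) 1)).toReal
  set I : ℝ := 2 ^ ((n : ℝ) + 1) * V * (3 * r) ^ (4 - 2 * s) * (1 - 2 ^ (-(4 - 2 * s)))⁻¹
  refine ⟨ENNReal.ofReal (kPs n s * r ^ 3 * 4 ^ p) * volume (ball (0 : E1 n) r) +
    ENNReal.ofReal (kPs n s * (1 + 2 * r) ^ p) * ENNReal.ofReal I, ?_, fun z => ?_⟩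
  · have : volume (ball (0 : E1 n) r) ≠ ⊤ := measure_ball_lt_top.ne
    finiteness
  have hz : 0 < 1 + ‖z‖ := by positivity
  rcases le_total (2 * r) ‖z‖ with h | h
  · refine le_trans ?_ (mul_le_mul_left le_self_add _)
    calc _ ≤ ∫⁻ _ in upperHalfBall n r,
          ENNReal.ofReal (kPs n s * r ^ 3 * (4 ^ p * (1 + ‖z‖) ^ (-p))) := by
          refine setLIntegral_mono' (measurableSet_upperHalfBall r) fun X hX => ?_
          have hXr : ‖X‖ < r := mem_ball_zero_iff.1 hX.2
          have hX0 : 0 < X (Fin.last n) := hX.1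
          refine ENNReal.ofReal_le_ofReal ?_
          rw [rpow_mul_Ps hX0]
          have hy : X (Fin.last n) ≤ r := by
            have := (PiLp.norm_apply_le X (Fin.last n)).trans hXr.le
            exact (le_abs_self _).trans this
          have hD : (1 + ‖z‖) * 4⁻¹ ≤ ‖bdryIncl n z - X‖ := by
            have := norm_sub_norm_le (bdryIncl n z) X
            rw [norm_bdryIncl] at this
            linarith
          refine mul_le_mul ?_ ?_ (by positivity) (by positivity)
          · gcongr
          · calc _ ≤ ((1 + ‖z‖) * 4⁻¹) ^ (-p) :=
                  Real.rpow_le_rpow_of_nonpos (by positivity) hD (by linarith)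
              _ = _ := by
                  rw [Real.mul_rpow hz.le (by norm_num), Real.inv_rpow (by norm_num),
                    ← Real.rpow_neg (by norm_num), neg_neg, mul_comm]
      _ ≤ ENNReal.ofReal (kPs n s * r ^ 3 * (4 ^ p * (1 + ‖z‖) ^ (-p))) *
            volume (ball (0 : E1 n) r) := by
          rw [setLIntegral_const]
          gcongr
          exact inter_subset_right
      _ = _ := by
          rw [← mul_assoc, ENNReal.ofReal_mul (by positivity)]
          ring
  · refine le_trans ?_ (mul_le_mul_left le_add_self _)
    have hI := lintegral_ball_rpow_le (μ := (volume : Measure (E1 n))) (x := bdryIncl n z)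
      (γ := ((n + 1 : ℕ) : ℝ)) (e := 4 - 2 * s) (ρ := 3 * r) (by positivity) (by linarith)
      ENNReal.toReal_nonneg (by positivity)
      (fun t ht => volume_ball_le (n := n + 1) (bdryIncl n z) ht)
    calc _ ≤ ∫⁻ X in upperHalfBall n r, ENNReal.ofReal (kPs n s) *
          ENNReal.ofReal (‖bdryIncl n z - X‖ ^ (4 - 2 * s - ((n + 1 : ℕ) : ℝ))) := by
          refine setLIntegral_mono' (measurableSet_upperHalfBall r) fun X hX => ?_
          have hX0 : 0 < X (Fin.last n) := hX.1
          rw [← ENNReal.ofReal_mul hk]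
          refine ENNReal.ofReal_le_ofReal ?_
          rw [rpow_mul_Ps hX0, mul_assoc]
          refine mul_le_mul_of_nonneg_left ?_ hk
          have hyD : X (Fin.last n) ≤ ‖bdryIncl n z - X‖ := by
            refine le_of_sq_le_sq ?_ (norm_nonneg _)
            rw [norm_sub_bdryIncl_sq]
            exact le_add_of_nonneg_left (by positivity)
          have hD0 := hX0.trans_le hyD
          calc _ ≤ ‖bdryIncl n z - X‖ ^ 3 * ‖bdryIncl n z - X‖ ^ (-p) := by gcongr
            _ = _ := by
              rw [← Real.rpow_natCast, ← Real.rpow_add hD0, hpdef]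
              congr 1; push_cast; ring
      _ ≤ ∫⁻ X in ball (bdryIncl n z) (3 * r), ENNReal.ofReal (kPs n s) *
          ENNReal.ofReal (‖bdryIncl n z - X‖ ^ (4 - 2 * s - ((n + 1 : ℕ) : ℝ))) := by
          refine lintegral_mono_set fun X hX => ?_
          have hXr : ‖X‖ < r := mem_ball_zero_iff.1 hX.2
          rw [mem_ball, dist_eq_norm]
          have := norm_sub_le X (bdryIncl n z)
          rw [norm_bdryIncl] at this
          linarith
      _ ≤ ENNReal.ofReal (kPs n s) * ENNReal.ofReal I := by
          rw [lintegral_const_mul' _ _ ENNReal.ofReal_ne_top]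
          refine mul_le_mul_right (hI.trans (le_of_eq ?_)) _
          push_cast
          rfl
      _ ≤ ENNReal.ofReal (kPs n s * ((1 + 2 * r) ^ p * (1 + ‖z‖) ^ (-p))) *
            ENNReal.ofReal I := by
          gcongr
          refine le_mul_of_one_le_right hk ?_
          rw [Real.rpow_neg hz.le, ← div_eq_mul_inv, one_le_div (by positivity)]
          exact Real.rpow_le_rpow hz.le (by linarith) hp
      _ = _ := by
          rw [← mul_assoc, ENNReal.ofReal_mul (by positivity)]
          ring

/-- The Poisson extension is bounded in weighted `L²` over half-balls. -/
theorem exists_lintegral_poisson_sq_le {s r : ℝ} (hs : 0 < s) (hs2 : s < 2) (hr : 1 ≤ r) :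
    ∃ C : ENNReal, C ≠ ⊤ ∧ ∀ W : En n → ENNReal, Measurable W →
      ∫⁻ X in upperHalfBall n r, ENNReal.ofReal (X (Fin.last n) ^ (3 - 2 * s)) *
        (∫⁻ z, ENNReal.ofReal (Ps n s (projx n X - z) (X (Fin.last n))) * W z) ^ 2 ≤
      C * ∫⁻ z, W z ^ 2 * ENNReal.ofReal ((1 + ‖z‖) ^ (-((n : ℝ) + 2 * s))) := by
  obtain ⟨C₀, hC₀, hmass⟩ := exists_lintegral_Ps_le (n := n) hs
  obtain ⟨C₁, hC₁, hball⟩ := exists_lintegral_upperHalfBall_Ps_le (n := n) hs hs2 hr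
  refine ⟨C₀ * C₁, by finiteness, fun W hW => ?_⟩
  have hproj : Measurable (projx n) := continuous_projx.measurable
  have hPm : Measurable fun q : E1 n × En n =>
      Ps n s (projx n q.1 - q.2) (q.1 (Fin.last n)) :=
    (measurable_Ps s).comp (f := fun q : E1 n × En n => (projx n q.1 - q.2, q.1 (Fin.last n)))
      (by fun_prop)
  set G : E1 n → En n → ENNReal := fun X z => ENNReal.ofReal
    (X (Fin.last n) ^ (3 - 2 * s) * Ps n s (projx n X - z) (X (Fin.last n))) * W z ^ 2 with hG
  have hGm : Measurable (Function.uncurry G) := by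
    simp only [hG, Function.uncurry_def]; fun_prop
  calc _ ≤ ∫⁻ X in upperHalfBall n r, C₀ * ∫⁻ z, G X z := by
        refine setLIntegral_mono' (measurableSet_upperHalfBall r) fun X hX => ?_
        have hX0 : 0 < X (Fin.last n) := hX.1
        have hPX : Measurable fun z : En n => Ps n s (projx n X - z) (X (Fin.last n)) :=
          hPm.comp (f := fun z : En n => (X, z)) (by fun_prop)
        have hsq : ∀ z : En n,
            ENNReal.ofReal (√(Ps n s (projx n X - z) (X (Fin.last n)))) ^ 2 =
            ENNReal.ofReal (Ps n s (projx n X - z) (X (Fin.last n))) := by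
          intro z
          rw [← ENNReal.ofReal_pow (Real.sqrt_nonneg _), Real.sq_sqrt (Ps_nonneg hs _ hX0.le)]
        have hcs := sq_lintegral_mul_le (ν := (volume : Measure (En n)))
          (f := fun z => ENNReal.ofReal (√(Ps n s (projx n X - z) (X (Fin.last n)))))
          (g := fun z => ENNReal.ofReal (√(Ps n s (projx n X - z) (X (Fin.last n)))) * W z)
          hPX.sqrt.ennreal_ofReal.aemeasurable
          (hPX.sqrt.ennreal_ofReal.mul hW).aemeasurable
        simp only [← mul_assoc, mul_pow, ← sq, hsq] at hcs
        calc _ ≤ ENNReal.ofReal (X (Fin.last n) ^ (3 - 2 * s)) * (C₀ *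
              ∫⁻ z, ENNReal.ofReal (Ps n s (projx n X - z) (X (Fin.last n))) * W z ^ 2) := by
              gcongr
              exact hcs.trans (mul_le_mul_left (hmass _ _ hX0) _)
          _ = _ := by
              rw [mul_left_comm, ← lintegral_const_mul' _ _ ENNReal.ofReal_ne_top]
              simp only [hG, ENNReal.ofReal_mul (Real.rpow_nonneg hX0.le _), mul_assoc]
    _ = C₀ * ∫⁻ z, ∫⁻ X in upperHalfBall n r, G X z := by
        rw [lintegral_const_mul' _ _ hC₀, lintegral_lintegral_swap hGm.aemeasurable]
    _ ≤ C₀ * ∫⁻ z, C₁ * (W z ^ 2 * ENNReal.ofReal ((1 + ‖z‖) ^ (-((n : ℝ) + 2 * s)))) := by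
        gcongr with z
        simp only [hG]
        have hPz : Measurable fun X : E1 n => Ps n s (projx n X - z) (X (Fin.last n)) :=
          hPm.comp (f := fun X : E1 n => (X, z)) (by fun_prop)
        rw [lintegral_mul_const _ (by fun_prop), mul_left_comm, mul_comm]
        gcongr
        exact hball z
    _ = _ := by rw [lintegral_const_mul' _ _ hC₁, mul_assoc]

end PoissonKernel

section FractionalLaplacian

variable {n : ℕ}

theorem exists_abs_second_difference_le {η : En n → ℝ} (hη : ContDiff ℝ 2 η)
    (hc : HasCompactSupport η) :
    ∃ C, 0 ≤ C ∧ ∀ x h, |2 * η x - η (x + h) - η (x - h)| ≤ C * ‖h‖ ^ 2 := by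
  obtain ⟨C, hC⟩ := ContDiff.lipschitzWith_of_hasCompactSupport (𝕂 := ℝ) (hc.fderiv (𝕜 := ℝ))
    (hη.fderiv_right (m := 1) (by norm_num)) one_ne_zero
  refine ⟨2 * C, by positivity, fun x h => ?_⟩
  have hd : Differentiable ℝ η := hη.differentiable (by norm_num)
  have hderiv : ∀ k : En n, HasFDerivAt (fun k => η (x + k) + η (x - k))
      (fderiv ℝ η (x + k) - fderiv ℝ η (x - k)) k := by
    intro k
    have h1 : HasFDerivAt (fun k => η (x + k)) (fderiv ℝ η (x + k)) k := by
      simpa [Function.comp_def] using (hd (x + k)).hasFDerivAt.comp k ((hasFDerivAt_id k).const_add x)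
    have h2 : HasFDerivAt (fun k => η (x - k)) (-fderiv ℝ η (x - k)) k := by
      simpa [Function.comp_def] using (hd (x - k)).hasFDerivAt.comp k ((hasFDerivAt_id k).const_sub x)
    rw [sub_eq_add_neg (fderiv ℝ η (x + k))]
    exact h1.add h2
  have hmvt := Convex.norm_image_sub_le_of_norm_fderiv_le (𝕜 := ℝ)
    (f := fun k => η (x + k) + η (x - k)) (s := closedBall 0 ‖h‖) (x := 0) (y := h)
    (C := 2 * C * ‖h‖) (fun k _ => (hderiv k).differentiableAt)
    (fun k hk => by
      rw [(hderiv k).fderiv]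
      have hk' : ‖k‖ ≤ ‖h‖ := mem_closedBall_zero_iff.1 hk
      have h1 := hC.dist_le_mul (x + k) (x - k)
      rw [dist_eq_norm, dist_eq_norm, show x + k - (x - k) = (2 : ℝ) • k by
        rw [two_smul]; abel, norm_smul, Real.norm_ofNat] at h1
      refine h1.trans ?_
      have := mul_le_mul_of_nonneg_left hk' C.coe_nonneg
      linarith)
    (convex_closedBall _ _) (by simp) (by simp)
  simp only [add_zero, sub_zero, Real.norm_eq_abs] at hmvt
  rw [abs_sub_comm] at hmvt
  calc _ = |η x + η x - (η (x + h) + η (x - h))| := by congr 1; ring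
    _ ≤ _ := hmvt.trans_eq (by ring)

theorem integrableOn_div_norm_rpow {f : En n → ℝ} (hf : Measurable f) {B p ε : ℝ}
    (hB : ∀ h, |f h| ≤ B) (hp : (n : ℝ) < p) (hε : 0 < ε) :
    IntegrableOn (fun h => f h / ‖h‖ ^ p) {h : En n | ε ≤ ‖h‖} := by
  have hS : MeasurableSet {h : En n | ε ≤ ‖h‖} := measurableSet_le measurable_const measurable_norm
  have hp0 : 0 < p := lt_of_le_of_lt (Nat.cast_nonneg n) hp
  have hB0 : 0 ≤ B := (abs_nonneg _).trans (hB 0)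
  have hi : Integrable (fun h : En n => (1 + ‖h‖) ^ (-p)) := by
    refine integrable_one_add_norm ?_
    rwa [finrank_euclideanSpace_fin]
  refine ((hi.const_mul (B * ((1 + ε) / ε) ^ p)).integrableOn).mono' ?_ ?_
  · exact Measurable.aestronglyMeasurable (by fun_prop)
  · rw [ae_restrict_iff' hS]
    refine Eventually.of_forall fun h (hh : ε ≤ ‖h‖) => ?_
    have hh0 : 0 < ‖h‖ := hε.trans_le hh
    have h1 : 1 + ‖h‖ ≤ (1 + ε) / ε * ‖h‖ := by
      rw [div_mul_eq_mul_div, le_div_iff₀ hε]; nlinarith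
    have h2 : (1 + ‖h‖) ^ p ≤ ((1 + ε) / ε) ^ p * ‖h‖ ^ p := by
      rw [← Real.mul_rpow (by positivity) hh0.le]
      exact Real.rpow_le_rpow (by positivity) h1 hp0.le
    rw [Real.norm_eq_abs, abs_div, abs_of_pos (a := ‖h‖ ^ p) (by positivity),
      Real.rpow_neg (by positivity), mul_assoc, div_eq_mul_inv]
    refine mul_le_mul (hB h) ?_ (by positivity) hB0
    rw [← div_eq_mul_inv, inv_le_iff_one_le_mul₀ (by positivity), div_mul_eq_mul_div,
      le_div_iff₀ (by positivity), one_mul]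
    exact h2

theorem integrable_second_difference {η : En n → ℝ} (hn : 0 < n) (hη : ContDiff ℝ 2 η)
    (hc : HasCompactSupport η) {σ : ℝ} (hσ : 0 < σ) (hσ1 : σ < 1) (x : En n) :
    Integrable fun h => (2 * η x - η (x + h) - η (x - h)) / ‖h‖ ^ ((n : ℝ) + 2 * σ) := by
  obtain ⟨C, hC0, hC⟩ := exists_abs_second_difference_le hη hc
  obtain ⟨B, hB⟩ := hc.exists_bound_of_continuous hη.continuous
  have hηc := hη.continuous
  have hn' : 0 < (n : ℝ) := by exact_mod_cast hn
  have hout : IntegrableOn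
      (fun h => (2 * η x - η (x + h) - η (x - h)) / ‖h‖ ^ ((n : ℝ) + 2 * σ))
      {h : En n | 1 ≤ ‖h‖} := by
    refine integrableOn_div_norm_rpow (B := 4 * B) (Continuous.measurable (by fun_prop))
      (fun h => ?_) (by linarith) one_pos
    have h1 := abs_le.1 (hB x)
    have h2 := abs_le.1 (hB (x + h))
    have h3 := abs_le.1 (hB (x - h))
    rw [abs_le]
    constructor <;> linarith
  have hin : IntegrableOn
      (fun h => (2 * η x - η (x + h) - η (x - h)) / ‖h‖ ^ ((n : ℝ) + 2 * σ))
      (ball (0 : En n) 1) := by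
    refine ⟨Measurable.aestronglyMeasurable (Measurable.div
      (Continuous.measurable (by fun_prop)) (by fun_prop)), ?_⟩
    have h := lintegral_ball_rpow_le (μ := (volume : Measure (En n))) (x := 0) (γ := n)
      (e := 2 - 2 * σ) (ρ := 1) hn' (by linarith) ENNReal.toReal_nonneg one_pos
      (fun t ht => volume_ball_le 0 ht)
    have hle : ∫⁻ h in ball (0 : En n) 1,
        ‖(2 * η x - η (x + h) - η (x - h)) / ‖h‖ ^ ((n : ℝ) + 2 * σ)‖ₑ ≤
        ∫⁻ h in ball (0 : En n) 1, ENNReal.ofReal C *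
          ENNReal.ofReal (‖0 - h‖ ^ (2 - 2 * σ - (n : ℝ))) := by
      refine lintegral_mono fun h => ?_
      simp only [zero_sub, norm_neg]
      rw [← ENNReal.ofReal_mul hC0, ← ofReal_norm]
      refine ENNReal.ofReal_le_ofReal ?_
      rcases eq_or_ne h 0 with rfl | hh
      · have : 2 * η x - η x - η x = 0 := by ring
        simp only [add_zero, sub_zero, this, zero_div, norm_zero]
        positivity
      · have hh0 : 0 < ‖h‖ := norm_pos_iff.2 hh
        rw [Real.norm_eq_abs, abs_div, abs_of_pos (a := ‖h‖ ^ ((n : ℝ) + 2 * σ)) (by positivity),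
          div_le_iff₀ (by positivity), mul_assoc, ← Real.rpow_add hh0,
          show 2 - 2 * σ - (n : ℝ) + ((n : ℝ) + 2 * σ) = ((2 : ℕ) : ℝ) by push_cast; ring,
          Real.rpow_natCast]
        exact hC x h
    refine hle.trans_lt ?_
    rw [lintegral_const_mul' _ _ ENNReal.ofReal_ne_top]
    exact ENNReal.mul_lt_top ENNReal.ofReal_lt_top (h.trans_lt ENNReal.ofReal_lt_top)
  have hun := hin.union hout
  rwa [show ball (0 : En n) 1 ∪ {h : En n | 1 ≤ ‖h‖} = univ by
    ext h; simp [lt_or_ge], integrableOn_univ] at hun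

/-- The principal value defining the fractional Laplacian of a test function converges. -/
theorem exists_tendsto_truncInt {η : En n → ℝ} (hn : 0 < n) (hη : ContDiff ℝ 2 η)
    (hc : HasCompactSupport η) {σ : ℝ} (hσ : 0 < σ) (hσ1 : σ < 1) (x : En n) :
    ∃ L, Tendsto (truncInt n σ η x) (nhdsWithin 0 (Ioi 0)) (nhds L) := by
  obtain ⟨B, hB⟩ := hc.exists_bound_of_continuous hη.continuous
  have hηc := hη.continuous
  set p : ℝ := (n : ℝ) + 2 * σ with hp
  set D : En n → ℝ := fun h => (2 * η x - η (x + h) - η (x - h)) / ‖h‖ ^ p with hD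
  have hDi : Integrable D := integrable_second_difference hn hη hc hσ hσ1 x
  have hS : ∀ ε : ℝ, MeasurableSet {h : En n | ε ≤ ‖h‖} := fun ε =>
    measurableSet_le measurable_const measurable_norm
  have heq : ∀ ε : ℝ, 0 < ε → truncInt n σ η x ε =
      2⁻¹ * ∫ h, {h : En n | ε ≤ ‖h‖}.indicator D h := by
    intro ε hε
    set G : En n → ℝ := {h : En n | ε ≤ ‖h‖}.indicator
      (fun h => (η x - η (x + h)) / ‖h‖ ^ p) with hG
    have hGi : Integrable G := by
      rw [hG, integrable_indicator_iff (hS ε)]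
      refine integrableOn_div_norm_rpow (B := 2 * B) (Continuous.measurable (by fun_prop))
        (fun h => ?_) (by linarith) hε
      have h1 := abs_le.1 (hB x)
      have h2 := abs_le.1 (hB (x + h))
      rw [abs_le]
      constructor <;> linarith
    have h1 : truncInt n σ η x ε = ∫ h, G h := by
      unfold truncInt
      rw [← integral_indicator (measurableSet_le measurable_const (by fun_prop)),
        ← integral_add_left_eq_self _ x]
      refine integral_congr_ae (Eventually.of_forall fun h => ?_)
      simp [hG, indicator_apply, dist_eq_norm, hp]
    have h2 : ∫ h, G (-h) = ∫ h, G h := integral_neg_eq_self G volume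
    have h3 : ∫ h, {h : En n | ε ≤ ‖h‖}.indicator D h = (∫ h, G h) + ∫ h, G (-h) := by
      rw [← integral_add hGi hGi.comp_neg]
      refine integral_congr_ae (Eventually.of_forall fun h => ?_)
      by_cases hh : ε ≤ ‖h‖
      · simp only [hG, hD, indicator_apply, mem_ofPred_eq, norm_neg, hh, if_true]
        rw [← add_div, ← sub_eq_add_neg x h]
        congr 1; ring
      · simp [hG, hh]
    rw [h1, h3, h2]; ring
  refine ⟨2⁻¹ * ∫ h, D h, ?_⟩
  have hlim : Tendsto (fun ε : ℝ => ∫ h, {h : En n | ε ≤ ‖h‖}.indicator D h)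
      (nhdsWithin 0 (Ioi 0)) (nhds (∫ h, D h)) := by
    refine tendsto_integral_filter_of_dominated_convergence (fun h => ‖D h‖) ?_ ?_ hDi.norm ?_
    · exact Eventually.of_forall fun ε => hDi.aestronglyMeasurable.indicator (hS ε)
    · exact Eventually.of_forall fun ε => Eventually.of_forall fun h =>
        norm_indicator_le_norm_self D h
    · refine Eventually.of_forall fun h => ?_
      refine tendsto_const_nhds.congr' ?_
      rcases eq_or_ne h 0 with rfl | hh
      · refine Eventually.of_forall fun ε => ?_
        have : D 0 = 0 := by
          simp only [hD, add_zero, sub_zero]; ring_nf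
        simp [indicator_apply, this]
      · have hpos : 0 < ‖h‖ := norm_pos_iff.2 hh
        filter_upwards [mem_nhdsWithin_of_mem_nhds (Iio_mem_nhds hpos)] with ε hε
        rw [indicator_of_mem]
        exact le_of_lt (mem_Iio.1 hε)
  refine (hlim.const_mul 2⁻¹).congr' ?_
  filter_upwards [self_mem_nhdsWithin] with ε hε
  exact (heq ε hε).symm

theorem truncInt_comp_smul_sub (σ : ℝ) (η : En n → ℝ) (a x : En n) {ρ : ℝ} (hρ : 0 < ρ) (ε : ℝ) :
    truncInt n σ (fun x => η (ρ⁻¹ • (x - a))) x ε =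
      ρ ^ (-(2 * σ)) * truncInt n σ η (ρ⁻¹ • (x - a)) (ε / ρ) := by
  set p : ℝ := (n : ℝ) + 2 * σ with hp
  set x' := ρ⁻¹ • (x - a) with hx'
  set g : En n → ℝ := {w : En n | ε / ρ ≤ dist x' w}.indicator
    (fun w => (η x' - η w) / dist x' w ^ p) with hg
  have hR : truncInt n σ η x' (ε / ρ) = ∫ w, g w := by
    unfold truncInt
    rw [← integral_indicator (measurableSet_le measurable_const (by fun_prop))]
  have hL : truncInt n σ (fun x => η (ρ⁻¹ • (x - a))) x ε =
      ∫ z, ρ ^ (-p) * g (ρ⁻¹ • (z - a)) := by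
    unfold truncInt
    rw [← integral_indicator (measurableSet_le measurable_const (by fun_prop))]
    refine integral_congr_ae (Eventually.of_forall fun z => ?_)
    have hdist : dist x' (ρ⁻¹ • (z - a)) = ρ⁻¹ * dist x z := by
      rw [hx', dist_smul₀, dist_sub_right, Real.norm_eq_abs, abs_of_pos (by positivity)]
    have hiff : ε / ρ ≤ ρ⁻¹ * dist x z ↔ ε ≤ dist x z := by
      rw [div_eq_inv_mul]; exact mul_le_mul_iff_right₀ (by positivity)
    simp only [hg, indicator_apply, mem_ofPred_eq, hdist, hiff]
    split_ifs
    · rw [Real.mul_rpow (by positivity) dist_nonneg, Real.inv_rpow hρ.le, Real.rpow_neg hρ.le]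
      have : 0 < ρ ^ p := by positivity
      rw [← mul_div_assoc, mul_div_mul_left _ _ (inv_ne_zero this.ne')]
    · simp
  rw [hL, hR, integral_const_mul, integral_sub_right_eq_self (fun z => g (ρ⁻¹ • z)) a,
    Measure.integral_comp_smul, finrank_euclideanSpace_fin, abs_of_pos (by positivity),
    smul_eq_mul, ← mul_assoc]
  congr 1
  rw [inv_pow, inv_inv, ← Real.rpow_natCast, ← Real.rpow_add hρ, hp]
  congr 1; ring

theorem fracLap_comp_smul_sub {η : En n → ℝ} (hn : 0 < n) (hη : ContDiff ℝ 2 η)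
    (hc : HasCompactSupport η) {σ : ℝ} (hσ : 0 < σ) (hσ1 : σ < 1) (a x : En n) {ρ : ℝ}
    (hρ : 0 < ρ) :
    fracLap n σ (fun x => η (ρ⁻¹ • (x - a))) x =
      ρ ^ (-(2 * σ)) * fracLap n σ η (ρ⁻¹ • (x - a)) := by
  obtain ⟨L, hL⟩ := exists_tendsto_truncInt hn hη hc hσ hσ1 (ρ⁻¹ • (x - a))
  have hdiv : Tendsto (fun ε : ℝ => ε / ρ) (nhdsWithin 0 (Ioi 0)) (nhdsWithin 0 (Ioi 0)) := by
    refine tendsto_nhdsWithin_of_tendsto_nhds_of_eventually_within _ ?_ ?_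
    · have : Tendsto (fun ε : ℝ => ε / ρ) (nhds 0) (nhds (0 / ρ)) :=
        (continuous_id.div_const ρ).tendsto 0
      rw [zero_div] at this
      exact this.mono_left nhdsWithin_le_nhds
    · filter_upwards [self_mem_nhdsWithin] with ε hε
      exact div_pos hε hρ
  have hL' : Tendsto (truncInt n σ (fun x => η (ρ⁻¹ • (x - a))) x) (nhdsWithin 0 (Ioi 0))
      (nhds (ρ ^ (-(2 * σ)) * L)) := by
    refine ((hL.comp hdiv).const_mul _).congr fun ε => ?_
    exact (truncInt_comp_smul_sub σ η a x hρ ε).symm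
  unfold fracLap
  rw [hL.limUnder_eq, hL'.limUnder_eq]
  ring

theorem integral_fracLap_sq_comp_smul_sub {η : En n → ℝ} (hn : 0 < n) (hη : ContDiff ℝ 2 η)
    (hc : HasCompactSupport η) {s : ℝ} (hs : 0 < s) (hs2 : s < 2) (a : En n) {ρ : ℝ}
    (hρ : 0 < ρ) :
    ∫ x, (fracLap n (s / 2) (fun x => η (ρ⁻¹ • (x - a))) x) ^ 2 =
      (∫ x, (fracLap n (s / 2) η x) ^ 2) * ρ ^ ((n : ℝ) - 2 * s) := by
  simp only [fracLap_comp_smul_sub hn hη hc (half_pos hs) (by linarith : s / 2 < 1) a _ hρ, mul_pow]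
  rw [integral_const_mul,
    integral_sub_right_eq_self (fun x => fracLap n (s / 2) η (ρ⁻¹ • x) ^ 2) a,
    Measure.integral_comp_smul volume (fun x => fracLap n (s / 2) η x ^ 2),
    finrank_euclideanSpace_fin, abs_of_pos (by positivity), smul_eq_mul, ← mul_assoc, mul_comm]
  congr 1
  rw [inv_pow, inv_inv, ← Real.rpow_natCast, ← Real.rpow_natCast, ← Real.rpow_mul hρ.le,
    ← Real.rpow_add hρ]
  congr 1; push_cast; ring

end FractionalLaplacian

section Morrey

variable {n : ℕ}

/-- Stability tested with a translated and dilated cutoff function. -/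
theorem StableOutsideBall.lintegral_exp_le {s R ρ : ℝ} {u η : En n → ℝ} (hn : 0 < n) (hs : 0 < s)
    (hs2 : s < 2) (hu : Continuous u) (hst : StableOutsideBall n s u R)
    (hη : ContDiff ℝ (⊤ : ℕ∞) η) (hc : HasCompactSupport η) (hρ : 0 < ρ) (a : En n)
    (hsupp : ∀ y ∈ tsupport η, R < ‖a + ρ • y‖) {A : Set (En n)} (hA : MeasurableSet A)
    (hone : ∀ z ∈ A, η (ρ⁻¹ • (z - a)) = 1) :
    ∫⁻ z in A, ENNReal.ofReal (Real.exp (u z)) ≤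
      ENNReal.ofReal ((∫ x, (fracLap n (s / 2) η x) ^ 2) * ρ ^ ((n : ℝ) - 2 * s)) := by
  set φ : En n → ℝ := fun x => η (ρ⁻¹ • (x - a)) with hφ
  have hφs : ContDiff ℝ (⊤ : ℕ∞) φ :=
    hη.comp ((contDiff_id.sub contDiff_const).const_smul ρ⁻¹)
  set K : Set (En n) := (fun y => a + ρ • y) '' tsupport η with hK
  have hKc : IsCompact K := hc.isCompact.image (by fun_prop)
  have hzero : ∀ x, x ∉ K → φ x = 0 := by
    intro x hx
    by_contra hne
    refine hx ⟨ρ⁻¹ • (x - a), subset_tsupport η hne, ?_⟩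
    simp [smul_smul, mul_inv_cancel₀ hρ.ne']
  have hφc : HasCompactSupport φ := HasCompactSupport.intro hKc hzero
  have htest : TestOn n (closedBall (0 : En n) R)ᶜ φ := by
    refine ⟨hφs, hφc, ?_⟩
    have hsub : tsupport φ ⊆ K :=
      closure_minimal (fun x hx => by_contra fun h => hx (hzero x h)) hKc.isClosed
    intro x hx
    obtain ⟨y, hy, rfl⟩ := hsub hx
    rw [mem_compl_iff, mem_closedBall_zero_iff, not_le]
    exact hsupp y hy
  have hφcont : Continuous φ := hφs.continuous
  have hint : Integrable fun x => Real.exp (u x) * φ x ^ 2 := by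
    refine Continuous.integrable_of_hasCompactSupport (by fun_prop) ?_
    refine HasCompactSupport.intro hKc fun x hx => ?_
    simp [hzero x hx]
  have hle := hst φ htest
  rw [hφ, integral_fracLap_sq_comp_smul_sub hn (hη.of_le (WithTop.coe_le_coe.2 le_top)) hc hs hs2 a hρ]
    at hle
  refine le_trans ?_ (ENNReal.ofReal_le_ofReal hle)
  rw [ofReal_integral_eq_lintegral_ofReal hint (Eventually.of_forall fun x => by positivity)]
  refine le_trans (setLIntegral_mono' hA fun z hz => ?_) (setLIntegral_le_lintegral A _)
  have h1 : φ z = 1 := hone z hz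
  rw [h1]
  simp

theorem exists_exp_le_on_closedBall {u : En n → ℝ} (hu : Continuous u) (t : ℝ) :
    ∃ E, 0 ≤ E ∧ ∀ z ∈ closedBall (0 : En n) t, Real.exp (u z) ≤ E := by
  obtain ⟨E, hE⟩ := (isCompact_closedBall (0 : En n) t).exists_bound_of_continuousOn
    (f := fun z => Real.exp (u z)) (by fun_prop)
  refine ⟨max E 0, le_max_right _ _, fun z hz => ?_⟩
  exact (le_abs_self _).trans ((hE z hz).trans (le_max_left _ _))

theorem setLIntegral_exp_ball_le {u : En n → ℝ} {E : ℝ} {x : En n} {t : ℝ} (hE0 : 0 ≤ E)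
    (ht : 0 < t) (hE : ∀ z ∈ ball x t, Real.exp (u z) ≤ E) :
    ∫⁻ z in ball x t, ENNReal.ofReal (Real.exp (u z)) ≤
      ENNReal.ofReal (E * (volume (ball (0 : En n) 1)).toReal * t ^ (n : ℝ)) := by
  calc _ ≤ ∫⁻ _ in ball x t, ENNReal.ofReal E :=
        setLIntegral_mono' measurableSet_ball fun z hz => ENNReal.ofReal_le_ofReal (hE z hz)
    _ ≤ _ := by
        rw [setLIntegral_const, mul_assoc, ENNReal.ofReal_mul hE0]
        exact mul_le_mul_right (volume_ball_le x ht) _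

/-- Mass bound on large balls centred at the origin, from stability on dyadic annuli. -/
theorem StableOutsideBall.exists_lintegral_exp_ball_zero_le {s R : ℝ} {u : En n → ℝ} (hs : 0 < s)
    (hs2 : s < 2) (hn : 2 * s < n) (hu : Continuous u) (hR : 0 < R)
    (hst : StableOutsideBall n s u R) :
    ∃ M, 0 ≤ M ∧ ∀ t, 1 ≤ t → ∫⁻ z in ball (0 : En n) t, ENNReal.ofReal (Real.exp (u z)) ≤
      ENNReal.ofReal (M * t ^ ((n : ℝ) - 2 * s)) := by
  have hn0 : 0 < n := by
    have : (0 : ℝ) < n := by linarith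
    exact_mod_cast this
  set γ : ℝ := (n : ℝ) - 2 * s with hγdef
  have hγ : 0 < γ := by linarith
  set m : ℝ → ENNReal := fun t => ∫⁻ z in ball (0 : En n) t, ENNReal.ofReal (Real.exp (u z))
    with hm
  have hmono : Monotone m := fun t t' h => lintegral_mono_set (ball_subset_ball h)
  let β : ContDiffBump (0 : En n) := ⟨1, 2, one_pos, one_lt_two⟩
  set ζ : En n → ℝ := fun x => β ((4 : ℝ)⁻¹ • x) - β x with hζ
  have hβs : ContDiff ℝ (⊤ : ℕ∞) β := β.contDiff
  have hζs : ContDiff ℝ (⊤ : ℕ∞) ζ := (hβs.comp (contDiff_id.const_smul (4 : ℝ)⁻¹)).sub hβs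
  have hζc : HasCompactSupport ζ := by
    refine HasCompactSupport.intro (isCompact_closedBall (0 : En n) 8) fun x hx => ?_
    rw [mem_closedBall_zero_iff, not_le] at hx
    simp only [hζ]
    rw [β.zero_of_le_dist, β.zero_of_le_dist, sub_zero]
    · rw [dist_zero_right]; change 2 ≤ ‖x‖; linarith
    · rw [dist_zero_right, norm_smul]; change 2 ≤ _; norm_num; linarith
  have hζsupp : ∀ y ∈ tsupport ζ, 1 ≤ ‖y‖ := by
    have : tsupport ζ ⊆ {y : En n | 1 ≤ ‖y‖} := by
      refine closure_minimal (fun y hy => ?_) (isClosed_le continuous_const continuous_norm)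
      by_contra hlt
      have hlt' : ‖y‖ < 1 := not_le.1 hlt
      refine hy ?_
      simp only [hζ]
      rw [β.one_of_mem_closedBall, β.one_of_mem_closedBall, sub_self]
      · rw [mem_closedBall_zero_iff]; exact hlt'.le
      · rw [mem_closedBall_zero_iff, norm_smul]; change _ ≤ (1 : ℝ); norm_num; linarith
    exact fun y hy => this hy
  set K : ℝ := ∫ x, (fracLap n (s / 2) ζ x) ^ 2 with hK
  have hK0 : 0 ≤ K := integral_nonneg fun x => sq_nonneg _
  have hann : ∀ t, 2 * (R + 1) ≤ t → m (2 * t) ≤ m t + ENNReal.ofReal (K * (t / 2) ^ γ) := by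
    intro t ht
    have ht0 : 0 < t / 2 := by linarith
    have hA : MeasurableSet {z : En n | t ≤ ‖z‖ ∧ ‖z‖ ≤ 2 * t} :=
      (measurableSet_le measurable_const measurable_norm).inter
        (measurableSet_le measurable_norm measurable_const)
    have hst' := hst.lintegral_exp_le hn0 hs hs2 hu hζs hζc ht0 0
      (fun y hy => by
        rw [zero_add, norm_smul, Real.norm_eq_abs, abs_of_pos ht0]
        have := hζsupp y hy
        nlinarith)
      hA (fun z hz => by
        have hz1 : t ≤ ‖z‖ := hz.1
        have hz2 : ‖z‖ ≤ 2 * t := hz.2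
        have hnorm : ‖(t / 2)⁻¹ • (z - 0)‖ = ‖z‖ / (t / 2) := by
          rw [sub_zero, norm_smul, Real.norm_eq_abs, abs_of_pos (by positivity)]
          ring
        simp only [hζ]
        rw [β.one_of_mem_closedBall, β.zero_of_le_dist, sub_zero]
        · rw [dist_zero_right, hnorm]; change 2 ≤ _
          rw [le_div_iff₀ ht0]; linarith
        · rw [mem_closedBall_zero_iff, norm_smul, hnorm]; change _ ≤ (1 : ℝ)
          have : ‖z‖ / (t / 2) ≤ 4 := by
            rw [div_le_iff₀ ht0]; linarith
          norm_num
          linarith)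
    refine le_trans ?_ (add_le_add_right hst' _)
    refine le_trans (lintegral_mono_set fun z hz => ?_) (lintegral_union_le _ _ _)
    rw [mem_ball_zero_iff] at hz
    rcases lt_or_ge ‖z‖ t with h | h
    · exact Or.inl (mem_ball_zero_iff.2 h)
    · exact Or.inr ⟨h, hz.le⟩
  set T : ℝ := 2 * (R + 1) with hT
  have hTpos : 0 < T := by positivity
  have hT1 : 1 ≤ T := by rw [hT]; linarith
  obtain ⟨E, hE0, hE⟩ := exists_exp_le_on_closedBall hu T
  set V : ℝ := (volume (ball (0 : En n) 1)).toReal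
  have hmT : m T ≤ ENNReal.ofReal (E * V * T ^ (n : ℝ)) :=
    setLIntegral_exp_ball_le hE0 hTpos fun z hz => hE z (ball_subset_closedBall hz)
  have h2γ : 1 < (2 : ℝ) ^ γ := Real.one_lt_rpow one_lt_two hγ
  set M₁ : ℝ := E * V * T ^ (n : ℝ) + K / (2 ^ γ - 1) with hM₁
  have hM₁0 : 0 ≤ M₁ := by
    have : 0 < (2 : ℝ) ^ γ - 1 := by linarith
    positivity
  have hKM : K ≤ M₁ * (2 ^ γ - 1) := by
    have h1 : 0 < (2 : ℝ) ^ γ - 1 := by linarith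
    rw [hM₁, add_mul, div_mul_cancel₀ _ h1.ne']
    have : 0 ≤ E * V * T ^ (n : ℝ) * (2 ^ γ - 1) := by positivity
    linarith
  have hdyad : ∀ k : ℕ, m (2 ^ k * T) ≤ ENNReal.ofReal (M₁ * (2 ^ k * T) ^ γ) := by
    intro k
    induction k with
    | zero =>
      rw [pow_zero, one_mul]
      refine hmT.trans (ENNReal.ofReal_le_ofReal ?_)
      have h1 : 1 ≤ T ^ γ := Real.one_le_rpow hT1 hγ.le
      have h2 : 0 ≤ K / (2 ^ γ - 1) := div_nonneg hK0 (by linarith)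
      calc _ ≤ M₁ := by rw [hM₁]; linarith
        _ ≤ M₁ * T ^ γ := le_mul_of_one_le_right hM₁0 h1
    | succ k ih =>
      have hle : T ≤ 2 ^ k * T := le_mul_of_one_le_left hTpos.le (one_le_pow₀ one_le_two)
      set t : ℝ := 2 ^ k * T with ht
      have ht0 : 0 < t := by positivity
      rw [show (2 : ℝ) ^ (k + 1) * T = 2 * t by rw [ht]; ring]
      refine (hann t hle).trans ((add_le_add_left ih _).trans ?_)
      rw [← ENNReal.ofReal_add (by positivity) (by positivity)]
      refine ENNReal.ofReal_le_ofReal ?_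
      have h1 : (t / 2) ^ γ ≤ t ^ γ := Real.rpow_le_rpow (by positivity) (by linarith) hγ.le
      rw [Real.mul_rpow (by norm_num) ht0.le]
      have h2 : K * (t / 2) ^ γ ≤ M₁ * (2 ^ γ - 1) * t ^ γ :=
        mul_le_mul hKM h1 (by positivity) (hK0.trans hKM)
      linarith
  refine ⟨M₁ * (2 * T) ^ γ, by positivity, fun t ht => ?_⟩
  have ht0 : 0 < t := by linarith
  obtain ⟨k, hk1, hk2⟩ := exists_nat_pow_near ht (y := 2) one_lt_two
  have h1 : t ≤ 2 ^ (k + 1) * T := hk2.le.trans (le_mul_of_one_le_right (by positivity) hT1)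
  refine (hmono h1).trans ((hdyad (k + 1)).trans (ENNReal.ofReal_le_ofReal ?_))
  rw [mul_assoc, ← Real.mul_rpow (by positivity) ht0.le]
  refine mul_le_mul_of_nonneg_left (Real.rpow_le_rpow (by positivity) ?_ hγ.le) hM₁0
  rw [pow_succ]
  nlinarith

/-- Stability outside a compact set gives the Morrey bound `∫_{B_ρ(x)} e^u ≤ M ρ^{n-2s}` on all
balls. -/
theorem StableOutsideBall.exists_lintegral_exp_ball_le {s R : ℝ} {u : En n → ℝ} (hs : 0 < s)
    (hs2 : s < 2) (hn : 2 * s < n) (hu : Continuous u) (hR : 0 < R)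
    (hst : StableOutsideBall n s u R) :
    ∃ M, 0 ≤ M ∧ ∀ x t, 0 < t → ∫⁻ z in ball (x : En n) t, ENNReal.ofReal (Real.exp (u z)) ≤
      ENNReal.ofReal (M * t ^ ((n : ℝ) - 2 * s)) := by
  have hn0 : 0 < n := by
    have : (0 : ℝ) < n := by linarith
    exact_mod_cast this
  obtain ⟨M₁, hM₁0, hM₁⟩ := hst.exists_lintegral_exp_ball_zero_le hs hs2 hn hu hR
  obtain ⟨E, hE0, hE⟩ := exists_exp_le_on_closedBall hu (R + 3)
  set γ : ℝ := (n : ℝ) - 2 * s with hγdef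
  have hγ : 0 < γ := by linarith
  let β : ContDiffBump (0 : En n) := ⟨1, 2, one_pos, one_lt_two⟩
  set K : ℝ := ∫ x, (fracLap n (s / 2) β x) ^ 2 with hK
  have hK0 : 0 ≤ K := integral_nonneg fun x => sq_nonneg _
  set V : ℝ := (volume (ball (0 : En n) 1)).toReal
  have hV : 0 ≤ V := ENNReal.toReal_nonneg
  have hEV : 0 ≤ E * V := mul_nonneg hE0 hV
  have hMR : 0 ≤ M₁ * (R + 3) ^ γ := by positivity
  refine ⟨K + M₁ * (R + 3) ^ γ + E * V, by positivity, fun x t ht => ?_⟩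
  have htγ : 0 < t ^ γ := by positivity
  have hfin : ∀ c, c ≤ K + M₁ * (R + 3) ^ γ + E * V →
      ENNReal.ofReal (c * t ^ γ) ≤ ENNReal.ofReal ((K + M₁ * (R + 3) ^ γ + E * V) * t ^ γ) :=
    fun c hc => ENNReal.ofReal_le_ofReal (mul_le_mul_of_nonneg_right hc htγ.le)
  rcases lt_or_ge (R + 2 * t) ‖x‖ with h | h
  · refine le_trans ?_ (hfin K (by linarith))
    refine hst.lintegral_exp_le hn0 hs hs2 hu β.contDiff β.hasCompactSupport ht x
      (fun y hy => ?_) measurableSet_ball (fun z hz => ?_)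
    · rw [β.tsupport_eq, mem_closedBall_zero_iff] at hy
      have hy' : ‖y‖ ≤ 2 := hy
      have h1 : ‖x‖ ≤ ‖x + t • y‖ + ‖t • y‖ := by simpa using norm_sub_le (x + t • y) (t • y)
      rw [norm_smul, Real.norm_eq_abs, abs_of_pos ht] at h1
      nlinarith
    · refine β.one_of_mem_closedBall ?_
      rw [mem_ball, dist_eq_norm] at hz
      rw [mem_closedBall_zero_iff, norm_smul, Real.norm_eq_abs, abs_of_pos (by positivity)]
      change _ ≤ (1 : ℝ)
      rw [inv_mul_le_iff₀ ht]; linarith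
  · rcases le_total 1 t with h1 | h1
    · refine le_trans ?_ (hfin (M₁ * (R + 3) ^ γ) (by linarith))
      have hsub : ball x t ⊆ ball (0 : En n) ((R + 3) * t) := by
        refine ball_subset_ball' ?_
        rw [dist_zero_right]; nlinarith
      refine (lintegral_mono_set hsub).trans ((hM₁ _ (by nlinarith)).trans (le_of_eq ?_))
      rw [Real.mul_rpow (by positivity) ht.le, mul_assoc]
    · refine le_trans ?_ (hfin (E * V) (by linarith))
      refine (setLIntegral_exp_ball_le hE0 ht fun z hz => hE z ?_).trans
        (ENNReal.ofReal_le_ofReal ?_)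
      · rw [mem_ball, dist_eq_norm] at hz
        rw [mem_closedBall_zero_iff]
        have h2 : ‖z‖ ≤ ‖x‖ + ‖z - x‖ := by
          simpa using norm_add_le x (z - x)
        linarith
      · refine mul_le_mul_of_nonneg_left ?_ hEV
        exact Real.rpow_le_rpow_of_exponent_ge ht h1 (by linarith)

/-- The Morrey bound is invariant under the rescaling `u ↦ u^λ`. -/
theorem lintegral_exp_uscale_ball_le {s M l : ℝ} {u : En n → ℝ} (hu : Continuous u) (hl : 0 < l)
    (hM : ∀ x t, 0 < t → ∫⁻ z in ball (x : En n) t, ENNReal.ofReal (Real.exp (u z)) ≤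
      ENNReal.ofReal (M * t ^ ((n : ℝ) - 2 * s))) (x : En n) {t : ℝ} (ht : 0 < t) :
    ∫⁻ z in ball x t, ENNReal.ofReal (Real.exp (uscale n s u l z)) ≤
      ENNReal.ofReal (M * t ^ ((n : ℝ) - 2 * s)) := by
  set f : En n → ENNReal := (ball (l • x) (l * t)).indicator
    fun z => ENNReal.ofReal (Real.exp (u z)) with hf
  have hfm : Measurable f := by
    have := hu.measurable
    exact Measurable.indicator (by fun_prop) measurableSet_ball
  have h1 : ∫⁻ z in ball x t, ENNReal.ofReal (Real.exp (uscale n s u l z)) =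
      ENNReal.ofReal (l ^ (2 * s)) * ∫⁻ z, f (l • z) := by
    rw [← lintegral_indicator measurableSet_ball, ← lintegral_const_mul' _ _ ENNReal.ofReal_ne_top]
    refine lintegral_congr fun z => ?_
    have hiff : l • z ∈ ball (l • x) (l * t) ↔ z ∈ ball x t := by
      rw [mem_ball, mem_ball, dist_smul₀, Real.norm_eq_abs, abs_of_pos hl]
      exact mul_lt_mul_iff_right₀ hl
    by_cases hz : z ∈ ball x t
    · rw [hf, indicator_of_mem hz, indicator_of_mem (hiff.2 hz), uscale, Real.exp_add,
        ← ENNReal.ofReal_mul (by positivity), Real.rpow_def_of_pos hl]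
      congr 1
      rw [mul_comm (2 * s)]; ring
    · rw [hf, indicator_of_notMem hz, indicator_of_notMem (fun h => hz (hiff.1 h)), mul_zero]
  have h2 := lintegral_eq_mul_lintegral_comp_smul hfm hl
  have h3 : ∫⁻ z, f z ≤ ENNReal.ofReal (M * (l * t) ^ ((n : ℝ) - 2 * s)) := by
    rw [hf, lintegral_indicator measurableSet_ball]
    exact hM (l • x) (l * t) (by positivity)
  have hln : ENNReal.ofReal (l ^ n) ≠ 0 := by
    rw [Ne, ENNReal.ofReal_eq_zero, not_le]; positivity
  rw [← ENNReal.mul_le_mul_iff_right hln ENNReal.ofReal_ne_top, h1, mul_left_comm, ← h2,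
    ← ENNReal.ofReal_mul (by positivity)]
  refine (mul_le_mul_right h3 _).trans (le_of_eq ?_)
  rw [← ENNReal.ofReal_mul (by positivity), Real.mul_rpow hl.le ht.le, Real.rpow_sub hl,
    Real.rpow_natCast]
  congr 1
  have : 0 < l ^ (2 * s) := by positivity
  field_simp

end Morrey

theorem enorm_wpot_le {n : ℕ} (s : ℝ) {g : En n → ℝ} (hg : Continuous g) (x : En n) :
    ‖wpot n s g x‖ₑ ≤ ‖cRiesz n s‖ₑ * absPot n ((n : ℝ) - 2 * s)
      (volume.withDensity fun z => ENNReal.ofReal (Real.exp (g z))) x := by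
  have hgm := hg.measurable
  unfold wpot absPot
  rw [enorm_mul, lintegral_withDensity_eq_lintegral_mul _ (by fun_prop) (by fun_prop)]
  refine mul_le_mul_right ((enorm_integral_le_lintegral_enorm _).trans (le_of_eq ?_)) _
  refine lintegral_congr fun z => ?_
  rw [enorm_mul, Real.enorm_eq_ofReal_abs, Real.enorm_eq_ofReal (Real.exp_pos _).le, Pi.mul_apply,
    mul_comm]

/-- (Lemma 4.11 of the paper.) Let `1 < s < α < 2`, `n > 2s`,
`n/(n-s) > 2α♯`.  Let `u ∈ C^{2α} ∩ L_{s/2}` solve `(-Δ)^s u = e^u` with `(-Δ)^{s/2}u → 0`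
at infinity, stable outside a compact set.  For `λ ≥ 1`, let `u^λ(x) = u(λx) + 2s log λ`,
`w^λ = c(n,s) ∫ (|x-z|^{2s-n} - (1+|z|)^{2s-n}) e^{u^λ(z)} dz`, and let `w_e^λ` be the
Poisson extension of `w^λ`.  Then for every `r ≥ 1` there is `C(r)`, independent of `λ`,
with `∫_{B_r^{n+1} ∩ ℝ^{n+1}_+} y^{3-2s} |w_e^λ|² ≤ C(r)` for all `λ ≥ 1`. -/
theorem weighted_L2_bound_of_extension
    (n : ℕ) (s α : ℝ) (hs : 1 < s) (hsα : s < α) (hα : α < 2)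
    (hn : 2 * s < (n : ℝ))
    (αsh αst : ℝ)
    (hr1 : αst ^ 3 - 8 * αst + 4 = 0) (hr2 : αsh ^ 3 - 8 * αsh + 4 = 0)
    (hlt : αsh < αst)
    (hmax : ∀ x : ℝ, x ^ 3 - 8 * x + 4 = 0 → x ≤ αst)
    (hsecond : ∀ x : ℝ, x ^ 3 - 8 * x + 4 = 0 → x ≠ αst → x ≤ αsh)
    (hdim : (n : ℝ) / ((n : ℝ) - s) > 2 * αsh)
    (u v : En n → ℝ)
    (hreg : CHolder (2 * α) u)
    (hL : MeasureTheory.Integrable (fun z : En n => |u z| / (1 + ‖z‖) ^ ((n : ℝ) + s)))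
    (hv : HasFracLap n (s / 2) u v)
    (hv0 : Filter.Tendsto v (Filter.cocompact (En n)) (nhds 0))
    (heq : HasFracLap n (s / 2) v (fun x => Real.exp (u x)))
    (hstable : ∃ R > 0, StableOutsideBall n s u R) :
    ∀ r : ℝ, 1 ≤ r → ∃ C > (0:ℝ), ∀ l : ℝ, 1 ≤ l →
      ∫ X in {X : E1 n | 0 < X (Fin.last n)} ∩ Metric.ball (0 : E1 n) r,
          (X (Fin.last n)) ^ (3 - 2 * s) *
            (poissonExt n s (wpot n s (uscale n s u l)) X) ^ 2 ≤ C := by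
  intro r hr
  obtain ⟨R, hR, hst⟩ := hstable
  have hu : Continuous u := hreg.1.continuous
  have hs0 : 0 < s := by linarith
  have hs2 : s < 2 := by linarith
  obtain ⟨M, hM0, hM⟩ := hst.exists_lintegral_exp_ball_le hs0 hs2 hn hu hR
  obtain ⟨C₁, hC₁, hpot⟩ := lintegral_absPot_sq_le hs hn hM0
  obtain ⟨C₂, hC₂, hpoi⟩ := exists_lintegral_poisson_sq_le (n := n) hs0 hs2 hr
  have hCfin : C₂ * (‖cRiesz n s‖ₑ ^ 2 * C₁) ≠ ⊤ := by finiteness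
  refine ⟨(C₂ * (‖cRiesz n s‖ₑ ^ 2 * C₁)).toReal + 1, by positivity, fun l hl => ?_⟩
  have hl0 : 0 < l := by linarith
  have hg : Continuous (uscale n s u l) := by
    unfold uscale
    fun_prop
  have hgm := hg.measurable
  set μ : Measure (En n) := volume.withDensity
    fun z => ENNReal.ofReal (Real.exp (uscale n s u l z)) with hμ
  have hμball : ∀ x t, 0 < t → μ (ball x t) ≤ ENNReal.ofReal (M * t ^ ((n : ℝ) - 2 * s)) := by
    intro x t ht
    rw [hμ, withDensity_apply _ measurableSet_ball]
    exact lintegral_exp_uscale_ball_le hu hl0 hM x ht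
  set W : En n → ENNReal := fun x => ‖cRiesz n s‖ₑ * absPot n ((n : ℝ) - 2 * s) μ x with hW
  have hWm : Measurable W := (measurable_absPot _ μ).const_mul _
  have hbound : ‖∫ X in upperHalfBall n r, (X (Fin.last n)) ^ (3 - 2 * s) *
      (poissonExt n s (wpot n s (uscale n s u l)) X) ^ 2‖ₑ ≤
      C₂ * (‖cRiesz n s‖ₑ ^ 2 * C₁) := by
    refine (enorm_integral_le_lintegral_enorm _).trans ?_
    calc _ ≤ ∫⁻ X in upperHalfBall n r, ENNReal.ofReal (X (Fin.last n) ^ (3 - 2 * s)) *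
          (∫⁻ z, ENNReal.ofReal (Ps n s (projx n X - z) (X (Fin.last n))) * W z) ^ 2 := by
          refine setLIntegral_mono' (measurableSet_upperHalfBall r) fun X hX => ?_
          have hX0 : 0 < X (Fin.last n) := hX.1
          rw [enorm_mul, enorm_pow, Real.enorm_eq_ofReal (by positivity)]
          gcongr
          refine (enorm_integral_le_lintegral_enorm _).trans (lintegral_mono fun z => ?_)
          rw [enorm_mul, Real.enorm_eq_ofReal (Ps_nonneg hs0 _ hX0.le)]
          gcongr
          exact enorm_wpot_le s hg z
      _ ≤ C₂ * ∫⁻ z, W z ^ 2 * ENNReal.ofReal ((1 + ‖z‖) ^ (-((n : ℝ) + 2 * s))) := hpoi W hWm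
      _ ≤ _ := by
          simp only [hW, mul_pow, mul_assoc]
          rw [lintegral_const_mul' _ _ (by finiteness)]
          gcongr
          exact hpot μ inferInstance hμball
  have hreal := ENNReal.toReal_mono hCfin hbound
  rw [toReal_enorm, Real.norm_eq_abs] at hreal
  exact (le_abs_self _).trans (hreal.trans (by linarith))
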